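/- arXiv:cond-mat/0004330 — 11 statements merged into one kernel-verified Lean document; each statement's English description precedes it below -/
import Mathlib

section
/- Let n be a natural number with n ∈ {5, 7, 8, 9} or n ≥ 11. Then there exists an integer k, relatively prime to n, with n/3 < k < n/2. -/
/-- For `n ∈ {5,7,8,9}` or `n ≥ 11`, there is an integer `k` relatively prime to `n` with
`n/3 < k < n/2` (as rational numbers, i.e. `2n < 6k` and `2k < n`). -/
theorem exists_coprime_in_n_third_n_half
    (n : ℕ) (hn : n = 5 ∨ n = 7 ∨ n = 8 ∨ n = 9 ∨ 11 ≤ n) :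
    ∃ k : ℤ, Int.gcd k (n : ℤ) = 1 ∧ 2 * (n : ℤ) < 6 * k ∧ 2 * k < (n : ℤ) := by
  simp only [← Int.isCoprime_iff_gcd_eq_one]
  obtain ⟨m, h | h | h⟩ : ∃ m : ℤ, (n : ℤ) = 2 * m + 1 ∨ (n : ℤ) = 4 * m ∨
      (n : ℤ) = 4 * m + 2 := by
    rcases Nat.even_or_odd' n with ⟨c, hc | hc⟩
    · exact ⟨c / 2, by omega⟩
    · exact ⟨c, by omega⟩
  · exact ⟨m, ⟨-2, 1, by rw [h]; ring⟩, by omega, by omega⟩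
  · exact ⟨2 * m - 1, ⟨-(2 * m + 1), m, by rw [h]; ring⟩, by omega, by omega⟩
  · exact ⟨2 * m - 1, ⟨-(2 * m ^ 2 + 2 * m + 1), m ^ 2, by rw [h]; ring⟩, by omega, by omega⟩
end

section
/- Let n ≥ 2 with n ≠ 10, let k be an integer with 1 ≤ k < n and gcd(k, n) = 1, and suppose that the generalized Beraha number B_n^{(k)} = 4·cos²(kπ/n) is not an integer. Let G be a simple graph on a finite vertex set, let P be the chromatic polynomial of G, and assume that P has no real root in the open interval (0, 1). Then P(B_n^{(k)}) ≠ 0; that is, B_n^{(k)} is not a chromatic root of G. -/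
open Polynomial in
/-- The generalized Beraha number in terms of a root of unity. -/
theorem ofReal_four_mul_cos_sq_eq (n k : ℕ) (hn : 2 ≤ n) (ζ : ℂ)
    (hζ : ζ = Complex.exp (2 * Real.pi * Complex.I * (k / n))) :
    ((4 * Real.cos ((k : ℝ) * Real.pi / n) ^ 2 : ℝ) : ℂ) =
      aeval ζ (2 + X + X ^ (n - 1) : ℤ[X]) := by
  have hn0 : (n : ℂ) ≠ 0 := by
    exact_mod_cast (by omega : n ≠ 0)
  have hpow : ζ ^ n = 1 := by
    rw [hζ, ← Complex.exp_nat_mul, Complex.exp_eq_one_iff]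
    exact ⟨k, by push_cast; field_simp⟩
  have hinv : ζ ^ (n - 1) = ζ⁻¹ := by
    apply eq_inv_of_mul_eq_one_left
    rw [← pow_succ, Nat.sub_add_cancel (by omega), hpow]
  set w : ℂ := Complex.exp ((k : ℂ) * Real.pi / n * Complex.I) with hw
  have hw0 : w ≠ 0 := Complex.exp_ne_zero _
  have hsq : ζ = w ^ 2 := by
    rw [hζ, hw, ← Complex.exp_nat_mul]
    congr 1
    push_cast
    ring
  have hcos : Complex.cos ((k : ℂ) * Real.pi / n) = (w + w⁻¹) / 2 := by
    rw [Complex.cos, hw, ← Complex.exp_neg, neg_mul]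
  simp only [map_add, map_pow, aeval_X, map_ofNat]
  push_cast
  rw [hcos, hinv, hsq]
  field_simp
  ring

open Polynomial in
/-- Generalized primitive Beraha numbers of the same order are roots of the same integer
polynomials. -/
theorem aeval_four_mul_cos_sq_eq_zero_of_coprime (n k j : ℕ) (hn : 2 ≤ n)
    (hk : Nat.Coprime k n) (hj : Nat.Coprime j n) (P : ℤ[X])
    (h : aeval (4 * Real.cos ((k : ℝ) * Real.pi / n) ^ 2) P = 0) :
    aeval (4 * Real.cos ((j : ℝ) * Real.pi / n) ^ 2) P = 0 := by
  have hn0 : n ≠ 0 := by omega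
  have key : ∀ i : ℕ, aeval (4 * Real.cos ((i : ℝ) * Real.pi / n) ^ 2) P = 0 ↔
      aeval (Complex.exp (2 * Real.pi * Complex.I * (i / n)))
        (P.comp (2 + X + X ^ (n - 1))) = 0 := by
    intro i
    rw [aeval_comp, ← ofReal_four_mul_cos_sq_eq n i hn _ rfl, ← Complex.coe_algebraMap,
      aeval_algebraMap_apply]
    simp
  rw [key] at h ⊢
  have hζk := Complex.isPrimitiveRoot_exp_of_coprime k n hn0 hk
  have hζj := Complex.isPrimitiveRoot_exp_of_coprime j n hn0 hj
  have hdvd : cyclotomic n ℤ ∣ P.comp (2 + X + X ^ (n - 1)) := by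
    rw [cyclotomic_eq_minpoly hζk (by omega)]
    exact minpoly.isIntegrallyClosed_dvd (hζk.isIntegral (by omega)) h
  refine aeval_eq_zero_of_dvd_aeval_eq_zero hdvd ?_
  rw [cyclotomic_eq_minpoly hζj (by omega)]
  exact minpoly.aeval _ _

/-- For all but a few `n` some residue coprime to `n` lies strictly between `n / 3` and `n / 2`. -/
theorem Nat.exists_coprime_lt_three_mul_and_two_mul_lt (n : ℕ) (hn : 5 ≤ n) (h6 : n ≠ 6)
    (h10 : n ≠ 10) : ∃ j : ℕ, Nat.Coprime j n ∧ n < 3 * j ∧ 2 * j < n := by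
  have hcop : ∀ m j d : ℕ, d = 1 ∨ d = 2 ∨ d = 4 → (d = 1 ∨ Odd j) → m = 2 * j + d →
      Nat.Coprime j m := by
    rintro m j d hd hodd rfl
    rw [mul_comm, Nat.coprime_mul_left_add_right]
    rcases hd with rfl | rfl | rfl
    · exact Nat.coprime_one_right j
    · exact Nat.coprime_two_right.2 (by simpa using hodd)
    · exact Nat.Coprime.pow_right 2 (Nat.coprime_two_right.2 (by simpa using hodd))
  obtain h | h | h : n % 2 = 1 ∨ n % 4 = 0 ∨ n % 4 = 2 := by omega
  · exact ⟨n / 2, hcop n _ 1 (by simp) (by simp) (by omega), by omega, by omega⟩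
  · exact ⟨n / 2 - 1, hcop n _ 2 (by simp) (Or.inr (Nat.odd_iff.2 (by omega))) (by omega),
      by omega, by omega⟩
  · exact ⟨n / 2 - 2, hcop n _ 4 (by simp) (Or.inr (Nat.odd_iff.2 (by omega))) (by omega),
      by omega, by omega⟩

theorem four_mul_cos_sq_mem_Ioo (n j : ℕ) (h₁ : n < 3 * j) (h₂ : 2 * j < n) :
    4 * Real.cos ((j : ℝ) * Real.pi / n) ^ 2 ∈ Set.Ioo (0 : ℝ) 1 := by
  have hn : (0 : ℝ) < n := by exact_mod_cast (by omega : 0 < n)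
  have h₁' : (n : ℝ) < 3 * j := by exact_mod_cast h₁
  have h₂' : 2 * (j : ℝ) < n := by exact_mod_cast h₂
  have hlo : Real.pi / 3 < j * Real.pi / n := by
    rw [div_lt_div_iff₀ (by norm_num) hn]
    nlinarith [Real.pi_pos]
  have hhi : j * Real.pi / n < Real.pi / 2 := by
    rw [div_lt_div_iff₀ hn (by norm_num)]
    nlinarith [Real.pi_pos]
  have hpos : 0 < Real.cos (j * Real.pi / n) :=
    Real.cos_pos_of_mem_Ioo ⟨by linarith [Real.pi_pos], hhi⟩
  have hlt : Real.cos (j * Real.pi / n) < 1 / 2 := by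
    rw [← Real.cos_pi_div_three]
    exact Real.cos_lt_cos_of_nonneg_of_le_pi (by positivity) (by linarith [Real.pi_pos]) hlo
  exact ⟨by positivity, by nlinarith⟩

theorem exists_int_eq_four_mul_cos_sq (n k : ℕ) (hk1 : 1 ≤ k) (hkn : k < n)
    (hgcd : Nat.gcd k n = 1) (hn : n ≤ 4 ∨ n = 6) :
    ∃ m : ℤ, 4 * Real.cos ((k : ℝ) * Real.pi / n) ^ 2 = (m : ℝ) := by
  have hn0 : (n : ℝ) ≠ 0 := by exact_mod_cast (by omega : n ≠ 0)
  have hone : ∃ m : ℤ, 4 * Real.cos (Real.pi / n) ^ 2 = (m : ℝ) := by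
    obtain rfl | rfl | rfl | rfl : n = 2 ∨ n = 3 ∨ n = 4 ∨ n = 6 := by omega
    · exact ⟨0, by simp⟩
    · exact ⟨1, by norm_num⟩
    · exact ⟨2, by norm_num [div_pow]⟩
    · exact ⟨3, by norm_num [div_pow]⟩
  have hk : k = 1 ∨ k + 1 = n := by
    obtain h | rfl := hn
    · interval_cases n <;> interval_cases k <;> simp_all
    · interval_cases k <;> simp_all
  rcases hk with rfl | hk
  · simpa using hone
  · have hk' : (k : ℝ) = n - 1 := by rw [← hk]; simp
    have harg : (k : ℝ) * Real.pi / n = Real.pi - Real.pi / n := by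
      rw [hk']
      field_simp
    rwa [harg, Real.cos_pi_sub, neg_sq]

/-- A noninteger primitive `n`-th generalized Beraha number `B_n^{(k)} = 4 cos²(kπ/n)`
(with `n ≠ 10`) is not a chromatic root of any graph, given that the chromatic polynomial
has no real root in the open interval `(0,1)` (a theorem of Read). -/
theorem generalized_beraha_number_not_chromatic_root
    (n : ℕ) (hn : 2 ≤ n) (hn10 : n ≠ 10)
    (k : ℕ) (hk1 : 1 ≤ k) (hkn : k < n) (hgcd : Nat.gcd k n = 1)
    (hB_not_int : ¬ ∃ m : ℤ, 4 * Real.cos ((k : ℝ) * Real.pi / n) ^ 2 = (m : ℝ))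
    (V : Type*) [Fintype V] (G : SimpleGraph V)
    (P : Polynomial ℤ)
    (hP : ∀ q : ℕ, P.eval (q : ℤ) =
      (Nat.card {f : V → Fin q // ∀ a b, G.Adj a b → f a ≠ f b} : ℤ))
    (hRead : ∀ x : ℝ, 0 < x → x < 1 → Polynomial.aeval x P ≠ 0) :
    Polynomial.aeval (4 * Real.cos ((k : ℝ) * Real.pi / n) ^ 2) P ≠ 0 := by
  intro h
  by_cases hsmall : n ≤ 4 ∨ n = 6
  · exact hB_not_int (exists_int_eq_four_mul_cos_sq n k hk1 hkn hgcd hsmall)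
  · obtain ⟨j, hj, h₁, h₂⟩ := Nat.exists_coprime_lt_three_mul_and_two_mul_lt n (by omega)
      (by omega) hn10
    obtain ⟨hpos, hlt⟩ := four_mul_cos_sq_mem_Ioo n j h₁ h₂
    exact hRead _ hpos hlt (aeval_four_mul_cos_sq_eq_zero_of_coprime n k j hn hgcd hj P h)
end

section
/- Let n ≥ 3 and let B_n = 4·cos²(π/n). Then the minimal polynomial of B_n over ℚ, pushed forward to ℝ[x], equals the product Π (x − 4·cos²(kπ/n)) taken over all integers k with 1 ≤ k ≤ n/2 and gcd(k, n) = 1; in particular, the minimal polynomial of B_n over ℚ has degree φ(n)/2, where φ is Euler's totient function. -/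
open Polynomial

lemma four_mul_cos_sq_eq_add_pow {n : ℕ} (hn : n ≠ 0) (k : ℕ) :
    ((4 * Real.cos ((k : ℝ) * Real.pi / n) ^ 2 : ℝ) : ℂ) =
      2 + Complex.exp (2 * Real.pi * Complex.I / n) ^ k +
        (Complex.exp (2 * Real.pi * Complex.I / n) ^ k) ^ (n - 1) := by
  have hn' : (n : ℂ) ≠ 0 := by exact_mod_cast hn
  set ζ := Complex.exp (2 * Real.pi * Complex.I / n) with hζ
  have h1 : ζ ^ n = 1 := (Complex.isPrimitiveRoot_exp n hn).pow_eq_one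
  have h2 : (ζ ^ k) ^ (n - 1) = (ζ ^ k)⁻¹ := by
    refine eq_inv_of_mul_eq_one_left ?_
    rw [← pow_succ, Nat.sub_add_cancel (Nat.one_le_iff_ne_zero.2 hn), ← pow_mul, mul_comm,
      pow_mul, h1, one_pow]
  have h3 : ζ ^ k = Complex.exp ((k * Real.pi / n : ℂ) * Complex.I) ^ 2 := by
    rw [hζ, ← Complex.exp_nat_mul, ← Complex.exp_nat_mul]
    congr 1
    push_cast
    ring
  rw [h2, h3]
  push_cast
  rw [Complex.cos, neg_mul, Complex.exp_neg]
  have := Complex.exp_ne_zero ((k * Real.pi / n : ℂ) * Complex.I)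
  field_simp
  ring

lemma isIntegral_four_mul_cos_pi_div_sq {n : ℕ} (hn : n ≠ 0) :
    IsIntegral ℚ (4 * Real.cos (Real.pi / n) ^ 2) := by
  have hζ : IsIntegral ℚ (Complex.exp (2 * Real.pi * Complex.I / n)) :=
    ((Complex.isPrimitiveRoot_exp n hn).isIntegral (Nat.pos_of_ne_zero hn)).tower_top
  rw [← isIntegral_algebraMap_iff (algebraMap ℝ ℂ).injective, Complex.coe_algebraMap,
    ← one_mul Real.pi, ← Nat.cast_one, four_mul_cos_sq_eq_add_pow hn 1]
  exact ((isIntegral_algebraMap (x := (2 : ℚ))).add (hζ.pow _)).add ((hζ.pow _).pow _)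

lemma aeval_four_mul_cos_sq_eq_zero {n k : ℕ} (hn : n ≠ 0) (hk : k.Coprime n) {p : ℚ[X]}
    (hp : aeval (4 * Real.cos (Real.pi / n) ^ 2) p = 0) :
    aeval (4 * Real.cos ((k : ℝ) * Real.pi / n) ^ 2) p = 0 := by
  have hζ := Complex.isPrimitiveRoot_exp n hn
  have key (j : ℕ) : aeval (Complex.exp (2 * Real.pi * Complex.I / n) ^ j)
      (p.comp (2 + X + X ^ (n - 1))) =
      ((aeval (4 * Real.cos ((j : ℝ) * Real.pi / n) ^ 2) p : ℝ) : ℂ) := by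
    rw [aeval_comp]
    have : aeval (Complex.exp (2 * Real.pi * Complex.I / n) ^ j)
        (2 + X + X ^ (n - 1) : ℚ[X]) =
        algebraMap ℝ ℂ (4 * Real.cos ((j : ℝ) * Real.pi / n) ^ 2) := by
      simp only [map_add, map_pow, aeval_X, map_ofNat]
      exact (four_mul_cos_sq_eq_add_pow hn j).symm
    rw [this, aeval_algebraMap_apply]
    rfl
  have h1 := key 1
  simp only [pow_one, Nat.cast_one, one_mul, hp, Complex.ofReal_zero] at h1
  have hdvd := minpoly.dvd ℚ _ h1
  rw [← cyclotomic_eq_minpoly_rat hζ (Nat.pos_of_ne_zero hn),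
    cyclotomic_eq_minpoly_rat (hζ.pow_of_coprime k hk) (Nat.pos_of_ne_zero hn)] at hdvd
  have h2 := key k
  rw [aeval_eq_zero_of_dvd_aeval_eq_zero hdvd (minpoly.aeval ℚ _)] at h2
  exact_mod_cast h2.symm

lemma injOn_four_mul_cos_sq {n : ℕ} (hn : n ≠ 0) :
    Set.InjOn (fun k : ℕ => 4 * Real.cos ((k : ℝ) * Real.pi / n) ^ 2) {k | 2 * k ≤ n} := by
  have hn' : (0 : ℝ) < n := by exact_mod_cast Nat.pos_of_ne_zero hn
  have hpi := Real.pi_pos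
  have bound {k : ℕ} (hk : 2 * k ≤ n) :
      0 ≤ (k : ℝ) * Real.pi / n ∧ (k : ℝ) * Real.pi / n ≤ Real.pi / 2 := by
    have : (2 * k : ℝ) ≤ n := by exact_mod_cast hk
    refine ⟨by positivity, ?_⟩
    rw [div_le_div_iff₀ hn' two_pos]
    nlinarith
  intro a ha b hb hab
  obtain ⟨ha0, ha1⟩ := bound ha
  obtain ⟨hb0, hb1⟩ := bound hb
  have hsq : Real.cos ((a : ℝ) * Real.pi / n) ^ 2 = Real.cos ((b : ℝ) * Real.pi / n) ^ 2 :=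
    mul_left_cancel₀ four_ne_zero hab
  have hcos := (pow_left_inj₀ (Real.cos_nonneg_of_mem_Icc ⟨by linarith, ha1⟩)
    (Real.cos_nonneg_of_mem_Icc ⟨by linarith, hb1⟩) two_ne_zero).1 hsq
  have harg := Real.injOn_cos ⟨ha0, by linarith⟩ ⟨hb0, by linarith⟩ hcos
  field_simp at harg
  exact_mod_cast harg

lemma totient_le_two_mul_card_coprime_le_half {n : ℕ} (hn : 2 ≤ n) :
    n.totient ≤ 2 * ((Finset.range (n + 1)).filter
      (fun k => 1 ≤ k ∧ 2 * k ≤ n ∧ Nat.gcd k n = 1)).card := by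
  set S := (Finset.range (n + 1)).filter (fun k => 1 ≤ k ∧ 2 * k ≤ n ∧ Nat.gcd k n = 1)
  have hsub : (Finset.range n).filter n.Coprime ⊆ S ∪ S.image (n - ·) := by
    intro k hk
    simp only [Finset.mem_filter, Finset.mem_range] at hk
    obtain ⟨hkn, hco⟩ := hk
    have hk0 : k ≠ 0 := by
      rintro rfl
      simp at hco
      omega
    rw [Finset.mem_union, Finset.mem_image]
    by_cases h : 2 * k ≤ n
    · left
      exact Finset.mem_filter.2 ⟨Finset.mem_range.2 (by omega), by omega, h, hco.symm⟩
    · right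
      refine ⟨n - k, Finset.mem_filter.2 ⟨Finset.mem_range.2 (by omega), by omega, by omega, ?_⟩,
        by omega⟩
      exact (Nat.coprime_self_sub_left hkn.le).2 hco.symm
  calc n.totient = ((Finset.range n).filter n.Coprime).card := rfl
    _ ≤ (S ∪ S.image (n - ·)).card := Finset.card_le_card hsub
    _ ≤ S.card + (S.image (n - ·)).card := Finset.card_union_le _ _
    _ ≤ 2 * S.card := by
      have := Finset.card_image_le (s := S) (f := (n - ·))
      omega

lemma exp_two_pi_mul_I_div_im_ne_zero {n : ℕ} (hn : 3 ≤ n) :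
    (Complex.exp (2 * Real.pi * Complex.I / n)).im ≠ 0 := by
  have hn' : (3 : ℝ) ≤ n := by exact_mod_cast hn
  have hpi := Real.pi_pos
  have : (2 * Real.pi * Complex.I / n : ℂ) = ((2 * Real.pi / n : ℝ) : ℂ) * Complex.I := by
    push_cast
    ring
  rw [this, Complex.exp_ofReal_mul_I_im]
  refine (Real.sin_pos_of_pos_of_lt_pi (by positivity) ?_).ne'
  rw [div_lt_iff₀ (by linarith)]
  nlinarith

lemma two_mul_natDegree_minpoly_four_mul_cos_sq_le {n : ℕ} (hn : 3 ≤ n) :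
    2 * (minpoly ℚ (4 * Real.cos (Real.pi / n) ^ 2)).natDegree ≤ n.totient := by
  have hn0 : n ≠ 0 := by omega
  set β : ℝ := 4 * Real.cos (Real.pi / n) ^ 2 with hβ
  set ζ := Complex.exp (2 * Real.pi * Complex.I / n) with hζdef
  have hζ : IsPrimitiveRoot ζ n := Complex.isPrimitiveRoot_exp n hn0
  have hζint : IsIntegral ℚ ζ := (hζ.isIntegral (Nat.pos_of_ne_zero hn0)).tower_top
  have hβζ : (β : ℂ) = 2 + ζ + ζ ^ (n - 1) := by
    simpa [hβ, hζdef] using four_mul_cos_sq_eq_add_pow hn0 1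
  have hmem : (β : ℂ) ∈ IntermediateField.adjoin ℚ {ζ} := by
    have := IntermediateField.mem_adjoin_simple_self ℚ ζ
    rw [hβζ]
    exact add_mem (add_mem (ofNat_mem _ 2) this) (pow_mem this _)
  have hle : IntermediateField.adjoin ℚ {(β : ℂ)} ≤ IntermediateField.adjoin ℚ {ζ} :=
    IntermediateField.adjoin_simple_le_iff.2 hmem
  have : FiniteDimensional ℚ (IntermediateField.adjoin ℚ {ζ}) :=
    IntermediateField.adjoin.finiteDimensional hζint
  have hβint : IsIntegral ℚ (β : ℂ) :=
    (isIntegral_four_mul_cos_pi_div_sq hn0).algebraMap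
  have hrankζ : Module.finrank ℚ (IntermediateField.adjoin ℚ {ζ}) = n.totient := by
    rw [IntermediateField.adjoin.finrank hζint,
      ← cyclotomic_eq_minpoly_rat hζ (Nat.pos_of_ne_zero hn0), natDegree_cyclotomic]
  have hrankβ : Module.finrank ℚ (IntermediateField.adjoin ℚ {(β : ℂ)}) =
      (minpoly ℚ β).natDegree := by
    rw [IntermediateField.adjoin.finrank hβint]
    congr 1
    exact minpoly.algebraMap_eq (algebraMap ℝ ℂ).injective β
  have hreal : IntermediateField.adjoin ℚ {(β : ℂ)} ≤
      ((Algebra.ofId ℝ ℂ).restrictScalars ℚ).fieldRange :=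
    IntermediateField.adjoin_simple_le_iff.2 ⟨β, rfl⟩
  have hne : IntermediateField.adjoin ℚ {(β : ℂ)} ≠ IntermediateField.adjoin ℚ {ζ} := by
    intro h
    obtain ⟨x, hx⟩ := hreal (h ▸ IntermediateField.mem_adjoin_simple_self ℚ ζ)
    refine exp_two_pi_mul_I_div_im_ne_zero hn ?_
    rw [← hζdef, ← hx]
    exact Complex.ofReal_im x
  have hdvd := IntermediateField.finrank_dvd_of_le_right hle
  have hlt : Module.finrank ℚ (IntermediateField.adjoin ℚ {(β : ℂ)}) ≠
      Module.finrank ℚ (IntermediateField.adjoin ℚ {ζ}) :=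
    fun h => hne (IntermediateField.eq_of_le_of_finrank_eq hle h)
  rw [hrankζ, hrankβ] at hdvd hlt
  obtain ⟨c, hc⟩ := hdvd
  have hpos := Nat.totient_pos.2 (Nat.pos_of_ne_zero hn0)
  have hc2 : 2 ≤ c := by
    by_contra! h
    interval_cases c <;> omega
  rw [hc, mul_comm]
  exact Nat.mul_le_mul_left _ hc2

/-- For `n ≥ 3`, the minimal polynomial over `ℚ` of the Beraha number `B_n = 4 cos²(π/n)`,
pushed forward to `ℝ[X]`, equals `∏ (X - 4 cos²(kπ/n))` over `1 ≤ k ≤ n/2` with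
`gcd(k,n) = 1`; in particular its degree is `φ(n)/2`. -/
theorem minpoly_beraha_number
    (n : ℕ) (hn : 3 ≤ n) :
    (minpoly ℚ (4 * Real.cos (Real.pi / n) ^ 2)).map (algebraMap ℚ ℝ) =
      ∏ k ∈ (Finset.range (n + 1)).filter
          (fun k => 1 ≤ k ∧ 2 * k ≤ n ∧ Nat.gcd k n = 1),
        (X - C (4 * Real.cos ((k : ℝ) * Real.pi / n) ^ 2)) ∧
    (minpoly ℚ (4 * Real.cos (Real.pi / n) ^ 2)).natDegree = Nat.totient n / 2 := by
  have hn0 : n ≠ 0 := by omega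
  have hupper := two_mul_natDegree_minpoly_four_mul_cos_sq_le hn
  have hcard := totient_le_two_mul_card_coprime_le_half (n := n) (by omega)
  set S := (Finset.range (n + 1)).filter (fun k => 1 ≤ k ∧ 2 * k ≤ n ∧ Nat.gcd k n = 1)
  set p := minpoly ℚ (4 * Real.cos (Real.pi / n) ^ 2)
  set Q : ℝ[X] := ∏ k ∈ S, (X - C (4 * Real.cos ((k : ℝ) * Real.pi / n) ^ 2))
  have hQmonic : Q.Monic := monic_prod_X_sub_C _ _
  have hQdeg : Q.natDegree = S.card := natDegree_finsetProd_X_sub_C_eq_card _ _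
  have hpmonic : (p.map (algebraMap ℚ ℝ)).Monic :=
    (minpoly.monic (isIntegral_four_mul_cos_pi_div_sq hn0)).map _
  have hdvd : Q ∣ p.map (algebraMap ℚ ℝ) := by
    refine Finset.prod_dvd_of_coprime (fun a ha b hb hab => ?_) fun k hk => ?_
    · refine isCoprime_X_sub_C_of_isUnit_sub (sub_ne_zero.2 fun h => hab ?_).isUnit
      exact injOn_four_mul_cos_sq hn0 (Finset.mem_filter.1 ha).2.2.1
        (Finset.mem_filter.1 hb).2.2.1 h
    · rw [dvd_iff_isRoot, IsRoot.def, eval_map_algebraMap]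
      exact aeval_four_mul_cos_sq_eq_zero hn0 (Finset.mem_filter.1 hk).2.2.2 (minpoly.aeval ℚ _)
  have hdeg : (p.map (algebraMap ℚ ℝ)).natDegree = p.natDegree := natDegree_map _
  have hlower := natDegree_le_of_dvd hdvd hpmonic.ne_zero
  refine ⟨eq_of_monic_of_dvd_of_natDegree_le hQmonic hpmonic hdvd (by omega), by omega⟩
end

section
/- (Fortuin–Kasteleyn representation.) Let G be a simple graph on a finite vertex set V, let R be a commutative ring, let v be an R-valued weight assigned to each edge of G, and let q be a natural number. Then Σ_{σ : V → Fin q} Π_{e = {x,y} ∈ E(G)} (1 + v(e)·[σ(x) = σ(y)]) = Σ_{F ⊆ E(G)} q^{k(F)} · Π_{e ∈ F} v(e), where [σ(x) = σ(y)] equals 1 if σ(x) = σ(y) and 0 otherwise, the sum on the right runs over all subsets F of the edge set of G, and k(F) denotes the number of connected components (including isolated vertices) of the spanning subgraph of G on vertex set V with edge set F. -/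
open Finset

/-- Functions constant along the edges of `H` are the functions on its connected components. -/
def SimpleGraph.adjConstantEquiv {V α : Type*} (H : SimpleGraph V) :
    {σ : V → α // ∀ x y, H.Adj x y → σ x = σ y} ≃ (H.ConnectedComponent → α) where
  toFun σ := SimpleGraph.ConnectedComponent.lift σ.1 fun _ _ p _ => by
    induction p with
    | nil => rfl
    | cons h _ ih => exact (σ.2 _ _ h).trans (ih (by simp_all))
  invFun f := ⟨fun x => f (H.connectedComponentMk x), fun _ _ h =>
    congrArg f (SimpleGraph.ConnectedComponent.sound h.reachable)⟩
  left_inv _ := rfl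
  right_inv f := by
    funext c
    induction c using SimpleGraph.ConnectedComponent.ind
    rfl

theorem SimpleGraph.forall_isDiag_map_iff {V α : Type*} (F : Set (Sym2 V)) (σ : V → α) :
    (∀ e ∈ F, (e.map σ).IsDiag) ↔
      ∀ x y, (SimpleGraph.fromEdgeSet F).Adj x y → σ x = σ y := by
  constructor
  · intro h x y hxy
    simpa using h _ hxy.1
  · intro h e he
    induction e using Sym2.ind with
    | _ x y =>
      rw [Sym2.map_mk, Sym2.mk_isDiag_iff]
      by_cases hxy : x = y
      · rw [hxy]
      · exact h x y ⟨he, hxy⟩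

theorem SimpleGraph.card_forall_isDiag_map {V α : Type*} [Finite V] (F : Set (Sym2 V)) :
    Nat.card {σ : V → α // ∀ e ∈ F, (e.map σ).IsDiag} =
      Nat.card α ^ Nat.card (SimpleGraph.fromEdgeSet F).ConnectedComponent := by
  rw [Nat.card_congr ((Equiv.subtypeEquivRight (SimpleGraph.forall_isDiag_map_iff F)).trans
    (SimpleGraph.fromEdgeSet F).adjConstantEquiv), Nat.card_fun]

/-- **Fortuin–Kasteleyn representation.**  For a finite simple graph `G`, edge weights `v`
in a commutative ring `R` and `q : ℕ`,
`∑_{σ : V → Fin q} ∏_{e ∈ E(G)} (1 + v e · [σ constant on e])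
  = ∑_{F ⊆ E(G)} q^{k(F)} ∏_{e ∈ F} v e`,
where `k(F)` is the number of connected components of the spanning subgraph `(V, F)`. -/
theorem fortuin_kasteleyn_representation
    (V : Type*) [Fintype V] [DecidableEq V]
    (G : SimpleGraph V) [DecidableRel G.Adj]
    (R : Type*) [CommRing R] (v : Sym2 V → R) (q : ℕ) :
    (∑ σ : V → Fin q, ∏ e ∈ G.edgeFinset,
        (1 + v e * (if (e.map σ).IsDiag then 1 else 0))) =
      ∑ F ∈ G.edgeFinset.powerset,
        (q : R) ^ (Nat.card (SimpleGraph.fromEdgeSet (↑F : Set (Sym2 V))).ConnectedComponent)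
          * ∏ e ∈ F, v e := by
  classical
  simp_rw [prod_one_add]
  rw [sum_comm]
  refine sum_congr rfl fun F _ => ?_
  simp_rw [prod_mul_distrib, prod_ite_zero, prod_const_one]
  rw [← mul_sum, mul_comm, sum_boole]
  congr 1
  have h := SimpleGraph.card_forall_isDiag_map (α := Fin q) (F : Set (Sym2 V))
  rw [Nat.card_eq_fintype_card, Fintype.card_subtype, Nat.card_fin] at h
  rw [← Nat.cast_pow, ← h]
  simp only [mem_coe]
end

section
/- Let G be a simple graph on a finite vertex set V. Then there exists a unique polynomial P with integer coefficients such that for every natural number q, P evaluated at q equals the number of proper q-colorings of G; moreover this polynomial P is monic and has degree equal to the number of vertices of G. -/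
/-- Two integer polynomials that agree at every natural number are equal. -/
theorem Polynomial.eq_of_forall_natCast_eval_eq {P Q : Polynomial ℤ}
    (h : ∀ q : ℕ, P.eval (q : ℤ) = Q.eval (q : ℤ)) : P = Q := by
  refine Polynomial.eq_of_infinite_eval_eq P Q ?_
  refine (Set.infinite_range_of_injective (Nat.cast_injective (R := ℤ))).mono ?_
  rintro _ ⟨q, rfl⟩
  exact h q

theorem Setoid.card_quotient_lt {V : Type*} [Finite V] {s : Setoid V} (hs : s ≠ ⊥) :
    Nat.card (Quotient s) < Nat.card V := by
  refine lt_of_le_of_ne (Nat.card_le_card_of_surjective _ Quotient.mk_surjective) fun h ↦ hs ?_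
  have hbij : Function.Bijective (Quotient.mk s) :=
    (Nat.bijective_iff_surjective_and_card _).2 ⟨Quotient.mk_surjective, h.symm⟩
  ext a b
  exact ⟨fun hab ↦ hbij.1 (Quotient.sound hab), fun hab ↦ hab ▸ s.refl a⟩

namespace SimpleGraph

variable {V : Type*} (G : SimpleGraph V)

/-- The partitions of the vertex set into independent sets, as equivalence relations. -/
abbrev IndepSetoid : Type _ := {s : Setoid V // ∀ a b, G.Adj a b → ¬ s a b}

/-- The discrete partition is a partition into independent sets. -/
def botIndepSetoid : G.IndepSetoid := ⟨⊥, fun _ _ h hab ↦ G.ne_of_adj h hab⟩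

instance [Finite V] : Finite G.IndepSetoid :=
  Finite.of_injective (fun s : G.IndepSetoid ↦ (fun a b ↦ s.1 a b : V → V → Prop))
    fun _ _ h ↦ Subtype.ext (Setoid.ext fun a b ↦ iff_of_eq (congrFun₂ h a b))

/-- A proper coloring amounts to a partition into independent sets together with an injective
assignment of colors to the parts. -/
noncomputable def sigmaEmbeddingEquivColoring (C : Type*) :
    (Σ s : G.IndepSetoid, Quotient s.1 ↪ C) ≃ {f : V → C // ∀ a b, G.Adj a b → f a ≠ f b} :=
  Equiv.ofBijective
    (fun x ↦ ⟨fun v ↦ x.2 (Quotient.mk _ v),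
      fun a b hab h ↦ x.1.2 a b hab (Quotient.exact (x.2.injective h))⟩) <| by
    constructor
    · rintro ⟨⟨s, hs⟩, e⟩ ⟨⟨t, ht⟩, e'⟩ h
      have h' : ∀ v, e (Quotient.mk _ v) = e' (Quotient.mk _ v) := congrFun (congrArg Subtype.val h)
      obtain rfl : s = t := by
        ext a b
        calc s a b ↔ e (Quotient.mk _ a) = e (Quotient.mk _ b) :=
              (Quotient.eq.symm).trans e.injective.eq_iff.symm
          _ ↔ e' (Quotient.mk _ a) = e' (Quotient.mk _ b) := by rw [h', h']
          _ ↔ t a b := e'.injective.eq_iff.trans Quotient.eq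
      obtain rfl : e = e' := by
        ext x
        induction x using Quotient.inductionOn with
        | h v => exact h' v
      rfl
    · rintro ⟨f, hf⟩
      exact ⟨⟨⟨Setoid.ker f, hf⟩, ⟨Setoid.kerLift f, Setoid.kerLift_injective f⟩⟩, rfl⟩

/-- The chromatic polynomial, as a sum of falling factorials over the partitions of the vertex set
into independent sets. -/
noncomputable def chromaticPolynomial [Finite V] : Polynomial ℤ :=
  letI := Fintype.ofFinite G.IndepSetoid
  ∑ s : G.IndepSetoid, descPochhammer ℤ (Nat.card (Quotient s.1))

theorem chromaticPolynomial_eval [Finite V] (q : ℕ) :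
    G.chromaticPolynomial.eval (q : ℤ) =
      (Nat.card {f : V → Fin q // ∀ a b, G.Adj a b → f a ≠ f b} : ℤ) := by
  classical
  let := Fintype.ofFinite G.IndepSetoid
  rw [← Nat.card_congr (G.sigmaEmbeddingEquivColoring (Fin q)), Nat.card_sigma,
    chromaticPolynomial, Polynomial.eval_finsetSum, Nat.cast_sum]
  refine Finset.sum_congr rfl fun s _ ↦ ?_
  let := Fintype.ofFinite (Quotient s.1)
  rw [descPochhammer_eval_eq_descFactorial, Nat.card_eq_fintype_card, Nat.card_eq_fintype_card,
    Fintype.card_embedding_eq, Fintype.card_fin]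

theorem chromaticPolynomial_monic_and_natDegree [Finite V] :
    G.chromaticPolynomial.Monic ∧ G.chromaticPolynomial.natDegree = Nat.card V := by
  classical
  let := Fintype.ofFinite G.IndepSetoid
  have hbot : Nat.card (Quotient G.botIndepSetoid.1) = Nat.card V :=
    (Nat.card_eq_of_bijective _
      ⟨fun _ _ h ↦ Quotient.exact (s := (⊥ : Setoid V)) h, Quotient.mk_surjective⟩).symm
  have hdeg (n : ℕ) : (descPochhammer ℤ n).degree = n := by
    rw [Polynomial.degree_eq_natDegree (monic_descPochhammer ℤ n).ne_zero, descPochhammer_natDegree]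
  have hlt : (∑ s ∈ Finset.univ.erase G.botIndepSetoid,
      descPochhammer ℤ (Nat.card (Quotient s.1))).degree <
      (descPochhammer ℤ (Nat.card V)).degree := by
    rw [hdeg, ← Polynomial.mem_degreeLT]
    refine Submodule.sum_mem _ fun s hs ↦ ?_
    rw [Polynomial.mem_degreeLT, hdeg, Nat.cast_lt]
    exact Setoid.card_quotient_lt fun h ↦ Finset.ne_of_mem_erase hs (Subtype.ext h)
  rw [chromaticPolynomial, ← Finset.add_sum_erase _ _ (Finset.mem_univ G.botIndepSetoid), hbot]
  exact ⟨(monic_descPochhammer ℤ _).add_of_left hlt, by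
    rw [Polynomial.natDegree_add_eq_left_of_degree_lt hlt, descPochhammer_natDegree]⟩

end SimpleGraph


/-- For every finite simple graph `G` there is a unique polynomial `P ∈ ℤ[X]` whose value
at every natural number `q` is the number of proper `q`-colorings of `G`; moreover this
chromatic polynomial is monic of degree equal to the number of vertices. -/
theorem exists_unique_chromatic_polynomial
    (V : Type*) [Fintype V] (G : SimpleGraph V) :
    (∃! P : Polynomial ℤ, ∀ q : ℕ, P.eval (q : ℤ) =
        (Nat.card {f : V → Fin q // ∀ a b, G.Adj a b → f a ≠ f b} : ℤ)) ∧
    (∀ P : Polynomial ℤ, (∀ q : ℕ, P.eval (q : ℤ) =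
        (Nat.card {f : V → Fin q // ∀ a b, G.Adj a b → f a ≠ f b} : ℤ)) →
      P.Monic ∧ P.natDegree = Fintype.card V) := by
  refine ⟨⟨G.chromaticPolynomial, G.chromaticPolynomial_eval, fun Q hQ ↦ ?_⟩, fun P hP ↦ ?_⟩
  · exact Polynomial.eq_of_forall_natCast_eval_eq fun q ↦
      (hQ q).trans (G.chromaticPolynomial_eval q).symm
  · obtain rfl : P = G.chromaticPolynomial := Polynomial.eq_of_forall_natCast_eval_eq fun q ↦
      (hP q).trans (G.chromaticPolynomial_eval q).symm
    rw [← Nat.card_eq_fintype_card]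
    exact G.chromaticPolynomial_monic_and_natDegree
end

section
/- (Temperley–Lieb relations.) Fix integers m ≥ 1 and q ≥ 1, and consider real matrices indexed by spin configurations σ : Fin m → Fin q. Define matrices D_x (for 1 ≤ x ≤ m) by D_x(σ′, σ) = 1 if σ(y) = σ′(y) for all y ≠ x and 0 otherwise, and J_{x,x+1} (for 1 ≤ x ≤ m−1) by J_{x,x+1}(σ′, σ) = 1 if σ = σ′ and σ(x) = σ(x+1), and 0 otherwise. Define operators e₁,…,e_{2m−1} by e_{2j−1} = q^{−1/2}·D_j for 1 ≤ j ≤ m and e_{2j} = q^{1/2}·J_{j,j+1} for 1 ≤ j ≤ m−1. Then these operators satisfy the Temperley–Lieb algebra relations: (i) e_i² = q^{1/2}·e_i for all 1 ≤ i ≤ 2m−1; (ii) e_i·e_{i±1}·e_i = e_i whenever both indices lie in {1,…,2m−1}; (iii) e_i·e_j = e_j·e_i whenever |i − j| > 1. -/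
/-- The Temperley–Lieb generators for the `q`-state Potts model on a strip of width `m`:
using 1-based indices `1 ≤ i ≤ 2m-1`, for odd `i = 2j-1` the operator is
`q^{-1/2} D_j` (the detach operator at site `j`, acting on spin configurations
`σ : Fin m → Fin q`, with sites numbered `0,…,m-1`), and for even `i = 2j` it is
`q^{1/2} J_{j,j+1}` (the join operator identifying sites `j` and `j+1`). -/
noncomputable def tlE (m q : ℕ) (i : ℕ) :
    Matrix (Fin m → Fin q) (Fin m → Fin q) ℝ :=
  if i % 2 = 1 then
    -- `i = 2j-1`: this is `q^{-1/2} • D_j`, with 0-based site index `(i-1)/2 = j-1`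
    (Real.sqrt q)⁻¹ • Matrix.of (fun σ' σ =>
      if ∀ y : Fin m, (y : ℕ) ≠ (i - 1) / 2 → σ y = σ' y then (1 : ℝ) else 0)
  else
    -- `i = 2j`: this is `q^{1/2} • J_{j,j+1}`, joining 0-based sites `i/2 - 1` and `i/2`
    Real.sqrt q • Matrix.of (fun σ' σ =>
      if σ = σ' ∧ ∀ x y : Fin m, (x : ℕ) = i / 2 - 1 → (y : ℕ) = i / 2 → σ x = σ y
      then (1 : ℝ) else 0)

namespace PottsTemperleyLieb

variable {ι κ : Type*} [Fintype ι] [DecidableEq κ]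

/-- The detach operator at the site `x`, which forgets the spin at `x`. -/
def detach [DecidableEq ι] (κ : Type*) [DecidableEq κ] (x : ι) : Matrix (ι → κ) (ι → κ) ℝ :=
  Matrix.of fun σ' σ => if ∀ y, y ≠ x → σ y = σ' y then 1 else 0

/-- The join operator at the sites `a` and `b`, which projects onto equal spins. -/
def join (κ : Type*) [DecidableEq κ] (a b : ι) : Matrix (ι → κ) (ι → κ) ℝ :=
  Matrix.diagonal fun σ => if σ a = σ b then 1 else 0

theorem join_comm (a b : ι) : join κ a b = join κ b a := by
  simp only [join, eq_comm]

variable [DecidableEq ι]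

theorem detach_update (x : ι) (s : κ) (σ τ : ι → κ) :
    detach κ x (Function.update σ x s) τ = detach κ x σ τ := by
  simp only [detach, Matrix.of_apply]
  refine if_congr (forall₂_congr fun y hy => ?_) rfl rfl
  rw [Function.update_of_ne hy]

variable [Fintype κ]

theorem join_mul_apply (a b : ι) (M : Matrix (ι → κ) (ι → κ) ℝ) (σ τ : ι → κ) :
    (join κ a b * M) σ τ = if σ a = σ b then M σ τ else 0 := by
  simp [join, Matrix.diagonal_mul]

theorem detach_mul_apply (x : ι) (M : Matrix (ι → κ) (ι → κ) ℝ) (σ τ : ι → κ) :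
    (detach κ x * M) σ τ = ∑ s, M (Function.update σ x s) τ := by
  rw [Matrix.mul_apply]
  simp only [detach, Matrix.of_apply, ite_mul, one_mul, zero_mul]
  rw [← Finset.sum_filter]
  symm
  refine Finset.sum_bij' (fun s _ => Function.update σ x s) (fun ρ _ => ρ x) ?_ ?_ ?_ ?_ ?_
  · intro s _
    simp +contextual [Function.update_of_ne]
  · simp
  · simp
  · intro ρ hρ
    simp only [Finset.mem_filter, Finset.mem_univ, true_and] at hρ
    ext y
    by_cases hy : y = x
    · subst hy; simp
    · simp [hy, hρ y hy]
  · simp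

theorem detach_mul_self (x : ι) :
    detach κ x * detach κ x = (Fintype.card κ : ℝ) • detach κ x := by
  ext σ τ
  simp [detach_mul_apply, detach_update]

theorem join_mul_self (a b : ι) : join κ a b * join κ a b = join κ a b := by
  simp [join]

theorem detach_mul_join_mul_detach {a b : ι} (h : a ≠ b) :
    detach κ a * join κ a b * detach κ a = detach κ a := by
  ext σ τ
  simp [mul_assoc, detach_mul_apply, join_mul_apply, detach_update, h.symm]

theorem join_mul_detach_mul_join {a b : ι} (h : a ≠ b) :
    join κ a b * detach κ a * join κ a b = join κ a b := by
  ext σ τ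
  have key : join κ a b σ τ = if σ a = σ b then join κ a b σ τ else 0 := by
    rw [← join_mul_apply, join_mul_self]
  rw [mul_assoc, join_mul_apply, detach_mul_apply, ← join_mul_self]
  simp only [join_mul_apply, Function.update_self, Function.update_of_ne h.symm,
    Finset.sum_ite_eq', Finset.mem_univ, if_true]
  split_ifs with hσ
  · rw [← hσ, Function.update_eq_self, key, if_pos hσ]
  · rfl

theorem commute_detach (x y : ι) : Commute (detach κ x) (detach κ y) := by
  rcases eq_or_ne x y with rfl | h
  · exact Commute.refl _
  suffices h_one : detach κ x * (detach κ y * 1) = detach κ y * (detach κ x * 1) by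
    simpa only [mul_one, commute_iff_eq] using h_one
  ext σ τ
  simp only [detach_mul_apply]
  rw [Finset.sum_comm]
  refine Finset.sum_congr rfl fun s _ => Finset.sum_congr rfl fun t _ => ?_
  rw [Function.update_comm h]

theorem commute_join (a b c d : ι) : Commute (join κ a b) (join κ c d) :=
  Matrix.commute_diagonal _ _

theorem commute_detach_join {x a b : ι} (ha : a ≠ x) (hb : b ≠ x) :
    Commute (detach κ x) (join κ a b) := by
  suffices h_one : detach κ x * (join κ a b * 1) = join κ a b * (detach κ x * 1) by
    simpa only [mul_one, commute_iff_eq] using h_one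
  ext σ τ
  simp only [detach_mul_apply, join_mul_apply, Function.update_of_ne ha, Function.update_of_ne hb]
  split_ifs <;> simp

end PottsTemperleyLieb

open PottsTemperleyLieb

theorem tlE_odd {m : ℕ} (q : ℕ) {j : ℕ} (hj : j < m) :
    tlE m q (2 * j + 1) = (Real.sqrt q)⁻¹ • detach (Fin q) (⟨j, hj⟩ : Fin m) := by
  rw [tlE, if_pos (by omega)]
  congr 1
  ext σ τ
  simp [detach, Fin.ext_iff]

theorem tlE_even {m : ℕ} (q : ℕ) {j : ℕ} (hj : j + 1 < m) :
    tlE m q (2 * j + 2) =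
      Real.sqrt q • join (Fin q) (⟨j, by omega⟩ : Fin m) ⟨j + 1, hj⟩ := by
  rw [tlE, if_neg (by omega)]
  congr 1
  ext σ τ
  have h_half : (2 * j + 2) / 2 = j + 1 := by omega
  have h_sites : (∀ x y : Fin m, (x : ℕ) = j → (y : ℕ) = j + 1 → τ x = τ y) ↔
      τ ⟨j, by omega⟩ = τ ⟨j + 1, hj⟩ := by
    refine ⟨fun h => h _ _ rfl rfl, ?_⟩
    rintro h ⟨x, _⟩ ⟨y, _⟩ rfl rfl
    exact h
  simp only [Matrix.of_apply, join, Matrix.diagonal_apply, h_half, Nat.add_sub_cancel,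
    h_sites]
  by_cases h : σ = τ
  · subst h; simp
  · simp [h, Ne.symm h]

/-- **Temperley–Lieb relations** for the operators `e₁, …, e_{2m-1}` built from the detach
and join operators of the `q`-state Potts model on a strip of width `m`:
(i) `eᵢ² = √q · eᵢ`; (ii) `eᵢ e_{i±1} eᵢ = eᵢ`; (iii) `eᵢ e_j = e_j eᵢ` for `|i-j| > 1`. -/
theorem temperley_lieb_relations (m q : ℕ) (hm : 1 ≤ m) (hq : 1 ≤ q) :
    (∀ i, 1 ≤ i → i ≤ 2 * m - 1 →
      tlE m q i * tlE m q i = Real.sqrt q • tlE m q i) ∧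
    (∀ i, 1 ≤ i → i + 1 ≤ 2 * m - 1 →
      tlE m q i * tlE m q (i + 1) * tlE m q i = tlE m q i) ∧
    (∀ i, 2 ≤ i → i ≤ 2 * m - 1 →
      tlE m q i * tlE m q (i - 1) * tlE m q i = tlE m q i) ∧
    (∀ i j, 1 ≤ i → i ≤ 2 * m - 1 → 1 ≤ j → j ≤ 2 * m - 1 →
      (i + 1 < j ∨ j + 1 < i) →
      tlE m q i * tlE m q j = tlE m q j * tlE m q i) := by
  have hr : Real.sqrt q ≠ 0 := by positivity
  have hr2 : Real.sqrt q * Real.sqrt q = q := Real.mul_self_sqrt (by positivity)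
  have parity : ∀ i, 1 ≤ i → i ≤ 2 * m - 1 →
      (∃ j, j < m ∧ i = 2 * j + 1) ∨ ∃ j, j + 1 < m ∧ i = 2 * j + 2 := by
    intro i h1 h2
    rcases Nat.even_or_odd' i with ⟨c, rfl | rfl⟩
    · exact Or.inr ⟨c - 1, by omega, by omega⟩
    · exact Or.inl ⟨c, by omega, rfl⟩
  refine ⟨?_, ?_, ?_, ?_⟩
  · intro i h1 h2
    obtain ⟨j, hj, rfl⟩ | ⟨j, hj, rfl⟩ := parity i h1 h2
    · rw [tlE_odd q hj, smul_mul_smul_comm, detach_mul_self, smul_smul, smul_smul,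
        Fintype.card_fin]
      nth_rw 3 [← hr2]
      congr 1
      field_simp
    · rw [tlE_even q hj, smul_mul_smul_comm, join_mul_self, smul_smul]
  · intro i h1 h2
    obtain ⟨j, hj, rfl⟩ | ⟨j, hj, rfl⟩ := parity i h1 (by omega)
    · have hj' : j + 1 < m := by omega
      rw [show 2 * j + 1 + 1 = 2 * j + 2 by ring, tlE_odd q hj, tlE_even q hj',
        smul_mul_smul_comm, smul_mul_smul_comm, detach_mul_join_mul_detach (by simp),
        inv_mul_cancel₀ hr, one_mul]
    · rw [show 2 * j + 2 + 1 = 2 * (j + 1) + 1 by ring, tlE_odd q hj, tlE_even q hj,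
        smul_mul_smul_comm, smul_mul_smul_comm, join_comm, join_mul_detach_mul_join (by simp),
        mul_inv_cancel₀ hr, one_mul]
  · intro i h1 h2
    obtain ⟨j, hj, rfl⟩ | ⟨j, hj, rfl⟩ := parity i (by omega) h2
    · obtain ⟨k, rfl⟩ : ∃ k, j = k + 1 := ⟨j - 1, by omega⟩
      rw [show 2 * (k + 1) + 1 - 1 = 2 * k + 2 by omega, tlE_odd q hj, tlE_even q hj,
        smul_mul_smul_comm, smul_mul_smul_comm, join_comm,
        detach_mul_join_mul_detach (by simp), inv_mul_cancel₀ hr, one_mul]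
    · have hj' : j < m := by omega
      rw [show 2 * j + 2 - 1 = 2 * j + 1 by omega, tlE_odd q hj', tlE_even q hj,
        smul_mul_smul_comm, smul_mul_smul_comm, join_mul_detach_mul_join (by simp),
        mul_inv_cancel₀ hr, one_mul]
  · intro i j hi1 hi2 hj1 hj2 hij
    change Commute (tlE m q i) (tlE m q j)
    obtain ⟨a, ha, rfl⟩ | ⟨a, ha, rfl⟩ := parity i hi1 hi2 <;>
      obtain ⟨b, hb, rfl⟩ | ⟨b, hb, rfl⟩ := parity j hj1 hj2
    · rw [tlE_odd q ha, tlE_odd q hb]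
      exact ((commute_detach _ _).smul_left _).smul_right _
    · rw [tlE_odd q ha, tlE_even q hb]
      refine ((commute_detach_join ?_ ?_).smul_left _).smul_right _ <;>
        simp only [ne_eq, Fin.mk.injEq] <;> omega
    · rw [tlE_even q ha, tlE_odd q hb]
      refine ((commute_detach_join ?_ ?_).symm.smul_left _).smul_right _ <;>
        simp only [ne_eq, Fin.mk.injEq] <;> omega
    · rw [tlE_even q ha, tlE_even q hb]
      exact ((commute_join _ _ _ _).smul_left _).smul_right _
end

section
/- Let q and n be natural numbers with n ≥ 1, and let G be the 3×n square-lattice strip with free boundary conditions, i.e. the box product of the path graph on 3 vertices with the path graph on n vertices. Let T be the 2×2 integer matrix (with entries depending polynomially on q, q cast to ℤ) T = [[q³−5q²+10q−8, q²−4q+5],[1, q−2]]. Then the number of proper q-colorings of G equals q·(q−1)·(uᵀ·T^{n−1}·v), where u is the column vector (q−1, 1) and v is the column vector (1, 0). -/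
open Matrix

namespace SquareStrip

/-- A column of the strip: the colors of its three vertices. -/
abbrev Column (q : ℕ) := Fin q × Fin q × Fin q

/-- The colors in a column form a proper coloring of the path on three vertices. -/
abbrev IsProper {q : ℕ} (c : Column q) : Prop := c.1 ≠ c.2.1 ∧ c.2.1 ≠ c.2.2

/-- The column `d` is proper and may stand next to the column `c`. -/
abbrev Follows {q : ℕ} (c d : Column q) : Prop :=
  (d.1 ≠ c.1 ∧ d.2.1 ≠ c.2.1 ∧ d.2.2 ≠ c.2.2) ∧ IsProper d

/-- Colorings of the `3 × n` grid are sequences of columns. -/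
def columnsEquiv (q n : ℕ) : (Fin 3 × Fin n → Fin q) ≃ (Fin n → Column q) where
  toFun f j := (f (0, j), f (1, j), f (2, j))
  invFun g p := ![(g p.2).1, (g p.2).2.1, (g p.2).2.2] p.1
  left_inv f := by
    funext ⟨i, j⟩
    fin_cases i <;> rfl
  right_inv g := rfl

theorem proper_iff {q n : ℕ} (f : Fin 3 × Fin (n + 1) → Fin q) :
    (∀ a b, ((SimpleGraph.pathGraph 3).boxProd (SimpleGraph.pathGraph (n + 1))).Adj a b →
        f a ≠ f b) ↔
      IsProper (columnsEquiv q (n + 1) f 0) ∧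
        ∀ i : Fin n, Follows (columnsEquiv q (n + 1) f i.castSucc)
          (columnsEquiv q (n + 1) f i.succ) := by
  simp only [SimpleGraph.boxProd_adj, SimpleGraph.pathGraph_adj, columnsEquiv]
  constructor
  · intro h
    have hcol (j : Fin (n + 1)) : f (0, j) ≠ f (1, j) ∧ f (1, j) ≠ f (2, j) :=
      ⟨h _ _ (by simp), h _ _ (by simp)⟩
    have hrow (k : Fin 3) (i : Fin n) : f (k, i.succ) ≠ f (k, i.castSucc) :=
      h _ _ (by simp)
    exact ⟨hcol 0, fun i => ⟨⟨hrow 0 i, hrow 1 i, hrow 2 i⟩, hcol i.succ⟩⟩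
  · rintro ⟨h0, hs⟩
    have hcol (j : Fin (n + 1)) : f (0, j) ≠ f (1, j) ∧ f (1, j) ≠ f (2, j) := by
      cases j using Fin.cases with
      | zero => exact h0
      | succ i => exact (hs i).2
    have hrow (k : Fin 3) (i j : Fin (n + 1)) (hij : i.val + 1 = j.val) : f (k, i) ≠ f (k, j) := by
      have hi : i.val < n := by omega
      obtain ⟨⟨r0, r1, r2⟩, -⟩ := hs ⟨i.val, hi⟩
      obtain rfl : (⟨i.val, hi⟩ : Fin n).succ = j := Fin.ext hij
      fin_cases k
      exacts [r0.symm, r1.symm, r2.symm]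
    rintro ⟨i, j⟩ ⟨k, l⟩ (⟨hik, rfl : j = l⟩ | ⟨hjl, rfl : i = k⟩)
    · obtain ⟨c0, c1⟩ := hcol j
      fin_cases i <;> fin_cases k <;> simp at hik
      exacts [c0, c0.symm, c1, c1.symm]
    · rcases hjl with hjl | hjl
      exacts [hrow i j l hjl, (hrow i l j hjl).symm]

/-- Weighted number of walks of length `n` starting at a given point, with step weights `r`. -/
def walkWeight {C : Type*} [Fintype C] (r : C → C → ℤ) : ℕ → C → ℤ
  | 0, _ => 1
  | n + 1, c => ∑ d, r c d * walkWeight r n d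

theorem sum_prod_eq_sum_walkWeight {C : Type*} [Fintype C] (r : C → C → ℤ)
    (n : ℕ) (g : C → ℤ) :
    ∑ f : Fin (n + 1) → C, g (f 0) * ∏ i : Fin n, r (f i.castSucc) (f i.succ) =
      ∑ c, g c * walkWeight r n c := by
  induction n generalizing g with
  | zero =>
    rw [← (Equiv.funUnique (Fin 1) C).symm.sum_comp]
    simp [walkWeight]
  | succ n ih =>
    rw [← (Fin.consEquiv fun _ => C).sum_comp, Fintype.sum_prod_type]
    refine Finset.sum_congr rfl fun c _ => ?_
    simp only [Fin.consEquiv_apply, Fin.cons_zero, Fin.prod_univ_succ, Fin.castSucc_zero,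
      Fin.cons_succ, ← Fin.succ_castSucc, walkWeight]
    rw [← Finset.mul_sum, ih (r c)]

theorem card_eq_sum_walkWeight (q n : ℕ) :
    (Nat.card {f : Fin 3 × Fin (n + 1) → Fin q //
        ∀ a b, ((SimpleGraph.pathGraph 3).boxProd (SimpleGraph.pathGraph (n + 1))).Adj a b →
          f a ≠ f b} : ℤ) =
      ∑ c : Column q, (if IsProper c then 1 else 0) *
        walkWeight (fun c d : Column q => if Follows c d then 1 else 0) n c := by
  rw [Nat.card_congr ((columnsEquiv q (n + 1)).subtypeEquiv
      (q := fun g => IsProper (g 0) ∧ ∀ i : Fin n, Follows (g i.castSucc) (g i.succ)) proper_iff),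
    Nat.card_eq_fintype_card, Fintype.card_subtype, Finset.card_filter, Nat.cast_sum,
    ← sum_prod_eq_sum_walkWeight]
  refine Finset.sum_congr rfl fun f _ => ?_
  rw [Finset.prod_ite_zero]
  simp only [Finset.mem_univ, true_imp_iff, Finset.prod_const_one, Nat.cast_ite, Nat.cast_one,
    Nat.cast_zero, ite_and, ite_mul, one_mul, zero_mul]

theorem sum_not_mem {α : Type*} [Fintype α] [DecidableEq α] (s : Finset α) :
    ∑ x, (if x ∉ s then (1 : ℤ) else 0) = Fintype.card α - s.card := by
  rw [Finset.sum_boole, Finset.filter_not, Finset.filter_mem_eq_inter, Finset.univ_inter,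
    Finset.cast_card_sdiff (Finset.subset_univ s), Finset.card_univ]

theorem sum_ne_ne {q : ℕ} (a y : Fin q) :
    ∑ x, (if x ≠ a ∧ x ≠ y then (1 : ℤ) else 0) = q - 2 + if y = a then 1 else 0 := by
  have h := sum_not_mem ({a, y} : Finset (Fin q))
  simp only [Finset.mem_insert, Finset.mem_singleton, not_or, Fintype.card_fin] at h
  rw [h]
  by_cases hy : y = a
  · subst hy
    simp
    ring
  · rw [Finset.card_pair (Ne.symm hy)]
    simp [hy]

theorem sum_ne_ne_ne {q : ℕ} (a c y : Fin q) :
    ∑ x, (if x ≠ a ∧ x ≠ y ∧ x ≠ c then (1 : ℤ) else 0) =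
      if a = c then (q : ℤ) - 2 + (if y = a then 1 else 0)
      else (q : ℤ) - 3 + (if y = a then 1 else 0) + (if y = c then 1 else 0) := by
  by_cases hac : a = c
  · subst hac
    rw [if_pos rfl, ← sum_ne_ne]
    refine Finset.sum_congr rfl fun x _ => ?_
    congr 1
    grind
  rw [if_neg hac]
  by_cases hya : y = a
  · subst hya
    have h := sum_ne_ne c y
    simp only [hac, if_false] at h
    have hswap (x : Fin q) : (x ≠ y ∧ x ≠ y ∧ x ≠ c) ↔ (x ≠ c ∧ x ≠ y) := by tauto
    simp only [hswap, h, if_true, hac, if_false]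
    ring
  by_cases hyc : y = c
  · subst hyc
    have h := sum_ne_ne a y
    simp only [hya, if_false] at h
    simp only [and_self, h, if_true, hya, if_false]
    ring
  · have h := sum_not_mem ({a, y, c} : Finset (Fin q))
    simp only [Finset.mem_insert, Finset.mem_singleton, not_or, Fintype.card_fin] at h
    simp only [ne_eq, h, hya, hyc, if_false]
    rw [Finset.card_eq_three.mpr ⟨a, y, c, Ne.symm hya, hac, hyc, rfl⟩]
    push_cast
    ring

/-- One step of the transfer: the weights constant on columns and supported on columns with equal
ends span an invariant space. -/
theorem sum_follows (q : ℕ) (c : Column q) (hc : IsProper c) (A B : ℤ) :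
    ∑ d : Column q, (if Follows c d then (1 : ℤ) else 0) * (A + B * if d.1 = d.2.2 then 1 else 0) =
      ((q : ℤ) ^ 3 - 5 * (q : ℤ) ^ 2 + 10 * (q : ℤ) - 8) * A + ((q : ℤ) ^ 2 - 4 * (q : ℤ) + 5) * B +
        (A + ((q : ℤ) - 2) * B) * if c.1 = c.2.2 then 1 else 0 := by
  obtain ⟨a, b, c⟩ := c
  obtain ⟨hab, hbc⟩ : a ≠ b ∧ b ≠ c := hc
  have hfiber (y : Fin q) :
      ∑ x, ∑ z, (if Follows (a, b, c) (x, y, z) then (1 : ℤ) else 0) *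
          (A + B * if x = z then 1 else 0) =
        (1 - if y = b then 1 else 0) *
          (A * ((q - 2 + if y = a then 1 else 0) * (q - 2 + if y = c then 1 else 0)) +
            B * if a = c then (q : ℤ) - 2 + (if y = a then 1 else 0)
              else (q : ℤ) - 3 + (if y = a then 1 else 0) + (if y = c then 1 else 0)) := by
    rw [← sum_ne_ne_ne, ← sum_ne_ne, ← sum_ne_ne, Finset.sum_mul_sum, Finset.mul_sum,
      Finset.mul_sum, ← Finset.sum_add_distrib, Finset.mul_sum]
    refine Finset.sum_congr rfl fun x _ => ?_
    have hdiag : (if x ≠ a ∧ x ≠ y ∧ x ≠ c then (1 : ℤ) else 0) =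
        ∑ z, (if x ≠ a ∧ x ≠ y then (1 : ℤ) else 0) * (if z ≠ c ∧ z ≠ y then 1 else 0) *
          (if x = z then 1 else 0) := by
      simp only [mul_ite, mul_one, mul_zero, Finset.sum_ite_eq, Finset.mem_univ, if_true]
      grind
    rw [hdiag, Finset.mul_sum, Finset.mul_sum, ← Finset.sum_add_distrib, Finset.mul_sum]
    refine Finset.sum_congr rfl fun z _ => ?_
    simp only [Follows, IsProper]
    by_cases hxa : x = a <;> by_cases hyb : y = b <;> by_cases hzc : z = c <;>
      by_cases hxy : x = y <;> by_cases hyz : y = z <;>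
      simp [hxa, hyb, hzc, hxy, hyz, eq_comm]
  have hsum (u v w : ℤ) :
      ∑ y, (1 - if y = b then 1 else 0) * (u + v * (if y = a then 1 else 0) +
          w * if y = c then 1 else 0) = u * (q - 1) + v + w := by
    simp only [sub_mul, one_mul, Finset.sum_sub_distrib, Finset.sum_add_distrib, mul_ite, mul_one,
      mul_zero, ite_mul, zero_mul, Finset.sum_ite_eq', Finset.mem_univ, if_true, hab.symm, hbc,
      if_false, Finset.sum_const, Finset.card_univ, Fintype.card_fin, nsmul_eq_mul]
    ring
  rw [Fintype.sum_prod_type]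
  simp only [Fintype.sum_prod_type]
  rw [Finset.sum_comm]
  simp only [hfiber]
  by_cases hac : a = c
  · subst hac
    have key := hsum (A * (q - 2) ^ 2 + B * (q - 2)) (A * (2 * q - 3) + B) 0
    simp only [if_true]
    refine (Finset.sum_congr rfl fun y _ => ?_).trans (key.trans (by ring))
    split_ifs <;> ring
  · have key := hsum (A * (q - 2) ^ 2 + B * (q - 3)) (A * (q - 2) + B) (A * (q - 2) + B)
    simp only [hac, if_false]
    refine (Finset.sum_congr rfl fun y _ => ?_).trans (key.trans (by ring))
    by_cases hya : y = a
    · have hyc : y ≠ c := fun h => hac (hya.symm.trans h)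
      simp only [hya, hac, if_true, if_false]
      ring
    · simp only [hya, if_false]
      split_ifs <;> ring

theorem sum_proper (q : ℕ) (A B : ℤ) :
    ∑ c : Column q, (if IsProper c then (1 : ℤ) else 0) * (A + B * if c.1 = c.2.2 then 1 else 0) =
      (q : ℤ) * ((q : ℤ) - 1) * (((q : ℤ) - 1) * A + B) := by
  have hne (y : Fin q) : ∑ x, (if x ≠ y then (1 : ℤ) else 0) = q - 1 := by
    simpa using sum_not_mem ({y} : Finset (Fin q))
  have hfiber (y : Fin q) :
      ∑ x, ∑ z, (if IsProper (x, y, z) then (1 : ℤ) else 0) * (A + B * if x = z then 1 else 0) =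
        A * ((q - 1) * (q - 1)) + B * (q - 1) := by
    have hdiag : (q : ℤ) - 1 = ∑ x : Fin q, ∑ z : Fin q, if x ≠ y ∧ x = z then 1 else 0 := by
      simp only [ite_and, ← hne y]
      refine Finset.sum_congr rfl fun x _ => ?_
      split_ifs <;> simp
    have hprod : ((q : ℤ) - 1) * (q - 1) =
        ∑ x : Fin q, ∑ z : Fin q, (if x ≠ y then 1 else 0) * if z ≠ y then 1 else 0 := by
      rw [← Finset.sum_mul_sum, hne]
    rw [hprod]
    conv_rhs => enter [2]; rw [hdiag]
    simp only [Finset.mul_sum, ← Finset.sum_add_distrib]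
    refine Finset.sum_congr rfl fun x _ => Finset.sum_congr rfl fun z _ => ?_
    simp only [IsProper]
    grind
  rw [Fintype.sum_prod_type]
  simp only [Fintype.sum_prod_type]
  rw [Finset.sum_comm]
  simp only [hfiber, Finset.sum_const, Finset.card_univ, Fintype.card_fin, nsmul_eq_mul]
  ring

theorem walkWeight_follows (q n : ℕ) (c : Column q) (hc : IsProper c) :
    walkWeight (fun c d : Column q => if Follows c d then 1 else 0) n c =
      ((!![(q : ℤ)^3 - 5*(q : ℤ)^2 + 10*(q : ℤ) - 8, (q : ℤ)^2 - 4*(q : ℤ) + 5;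
          1, (q : ℤ) - 2] ^ n).mulVec ![1, 0]) 0 +
        ((!![(q : ℤ)^3 - 5*(q : ℤ)^2 + 10*(q : ℤ) - 8, (q : ℤ)^2 - 4*(q : ℤ) + 5;
          1, (q : ℤ) - 2] ^ n).mulVec ![1, 0]) 1 * if c.1 = c.2.2 then 1 else 0 := by
  induction n generalizing c with
  | zero => simp [walkWeight]
  | succ n ih =>
    rw [pow_succ', ← Matrix.mulVec_mulVec]
    generalize (!![(q : ℤ)^3 - 5*(q : ℤ)^2 + 10*(q : ℤ) - 8, (q : ℤ)^2 - 4*(q : ℤ) + 5;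
          1, (q : ℤ) - 2] ^ n).mulVec ![1, 0] = w at ih ⊢
    have hstep := sum_follows q c hc (w 0) (w 1)
    simp only [walkWeight]
    refine (Finset.sum_congr rfl fun d _ => ?_).trans (hstep.trans ?_)
    · by_cases hd : Follows c d
      · rw [ih d hd.2]
      · simp only [hd, if_false, zero_mul]
    · simp [Matrix.mulVec, dotProduct, Fin.sum_univ_two]

end SquareStrip

open SquareStrip in
/-- Transfer-matrix formula for the chromatic polynomial of the `3 × n` square-lattice strip
with free boundary conditions (`P₃ □ Pₙ`): the number of proper `q`-colorings equals
`q (q-1) · uᵀ T^{n-1} v` with the indicated `2 × 2` transfer matrix `T` and vectors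
`u = (q-1, 1)`, `v = (1, 0)`. -/
theorem chromatic_polynomial_square_strip_3F
    (q n : ℕ) (hn : 1 ≤ n) :
    (Nat.card {f : Fin 3 × Fin n → Fin q //
        ∀ a b, ((SimpleGraph.pathGraph 3).boxProd (SimpleGraph.pathGraph n)).Adj a b →
          f a ≠ f b} : ℤ) =
      (q : ℤ) * ((q : ℤ) - 1) *
        (![(q : ℤ) - 1, 1] ⬝ᵥ
          ((!![(q : ℤ)^3 - 5*(q : ℤ)^2 + 10*(q : ℤ) - 8, (q : ℤ)^2 - 4*(q : ℤ) + 5;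
               1, (q : ℤ) - 2]) ^ (n - 1)).mulVec ![1, 0]) := by
  obtain ⟨n, rfl⟩ := Nat.exists_eq_add_of_le' hn
  rw [card_eq_sum_walkWeight, Nat.add_sub_cancel]
  have hw := walkWeight_follows q n
  generalize (!![(q : ℤ)^3 - 5*(q : ℤ)^2 + 10*(q : ℤ) - 8, (q : ℤ)^2 - 4*(q : ℤ) + 5;
          1, (q : ℤ) - 2] ^ n).mulVec ![1, 0] = w at hw ⊢
  refine (Finset.sum_congr rfl fun c _ => ?_).trans ((sum_proper q (w 0) (w 1)).trans ?_)
  · by_cases hc : IsProper c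
    · rw [hw c hc]
    · simp only [hc, if_false, zero_mul]
  · simp [dotProduct, Fin.sum_univ_two]
end

section
/- Let q and n be natural numbers with n ≥ 1, and let G be the 3×n square-lattice strip with periodic transverse boundary conditions, i.e. the box product of the cycle graph on 3 vertices with the path graph on n vertices. Then the number of proper q-colorings of G equals q·(q−1)·(q−2)·(q³−6q²+14q−13)^{n−1}, as an identity of integers (with q cast to ℤ). -/
/-- Walks with `m` steps along a relation `R` in which every element has exactly `k` predecessors
number `|S| * k ^ m`. -/
theorem card_chains_of_card_predecessors {S : Type*} [Finite S] (R : S → S → Prop) (k : ℤ)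
    (h : ∀ t, (Nat.card {s // R s t} : ℤ) = k) (m : ℕ) :
    (Nat.card {g : Fin (m + 1) → S // ∀ i : Fin m, R (g i.castSucc) (g i.succ)} : ℤ) =
      Nat.card S * k ^ m := by
  induction m with
  | zero =>
    have e : {g : Fin (0 + 1) → S // ∀ i : Fin 0, R (g i.castSucc) (g i.succ)} ≃ S :=
      (Equiv.subtypeUnivEquiv fun _ i => i.elim0).trans (Equiv.funUnique (Fin 1) S)
    rw [Nat.card_congr e, pow_zero, mul_one]
  | succ m ih =>
    have e : {g : Fin (m + 1 + 1) → S // ∀ i : Fin (m + 1), R (g i.castSucc) (g i.succ)} ≃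
        Σ g : {g : Fin (m + 1) → S // ∀ i : Fin m, R (g i.castSucc) (g i.succ)},
          {s // R s (g.1 0)} :=
      { toFun := fun g => ⟨⟨Fin.tail g.1, fun i => g.2 i.succ⟩, ⟨g.1 0, g.2 0⟩⟩
        invFun := fun p => ⟨Fin.cons p.2.1 p.1.1,
          Fin.forall_fin_succ.2 ⟨p.2.2, fun i => p.1.2 i⟩⟩
        left_inv := fun g => Subtype.ext (Fin.cons_self_tail g.1)
        right_inv := fun p => rfl }
    have := Fintype.ofFinite {g : Fin (m + 1) → S // ∀ i : Fin m, R (g i.castSucc) (g i.succ)}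
    rw [Nat.card_congr e, Nat.card_sigma]
    push_cast
    simp only [h, Finset.sum_const, Finset.card_univ, nsmul_eq_mul]
    rw [← Nat.card_eq_fintype_card, ih, pow_succ, mul_assoc]

/-- The injective triples that differ from a given injective triple in every coordinate. -/
theorem card_embedding_fin_three_forall_ne {q : ℕ} (t : Fin 3 ↪ Fin q) :
    (Nat.card {s : Fin 3 ↪ Fin q // ∀ i, s i ≠ t i} : ℤ) =
      (q : ℤ) ^ 3 - 6 * (q : ℤ) ^ 2 + 14 * (q : ℤ) - 13 := by
  have hxy : t 0 ≠ t 1 := t.injective.ne (by decide)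
  have hxz : t 0 ≠ t 2 := t.injective.ne (by decide)
  have hyz : t 1 ≠ t 2 := t.injective.ne (by decide)
  have e : {s : Fin 3 ↪ Fin q // ∀ i, s i ≠ t i} ≃
      {p : Fin q × Fin q × Fin q // p.1 ≠ t 0 ∧ (p.2.1 ≠ p.1 ∧ p.2.1 ≠ t 1) ∧
        p.2.2 ≠ p.1 ∧ p.2.2 ≠ p.2.1 ∧ p.2.2 ≠ t 2} :=
    { toFun := fun s => ⟨(s.1 0, s.1 1, s.1 2), s.2 0,
        ⟨s.1.injective.ne (by decide), s.2 1⟩, s.1.injective.ne (by decide),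
        s.1.injective.ne (by decide), s.2 2⟩
      invFun := fun p => ⟨⟨![p.1.1, p.1.2.1, p.1.2.2], by
        obtain ⟨⟨a, b, c⟩, h⟩ := p
        dsimp only at h
        intro i j hij
        fin_cases i <;> fin_cases j <;> simp at hij ⊢ <;> grind⟩, by
        obtain ⟨⟨a, b, c⟩, h⟩ := p
        intro i
        fin_cases i <;> simp_all⟩
      left_inv := fun s => by
        ext i
        fin_cases i <;> rfl
      right_inv := fun p => rfl }
  rw [Nat.card_congr e, Nat.card_eq_fintype_card, Fintype.card_subtype, Finset.card_filter]
  generalize t 0 = x at *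
  generalize t 1 = y at *
  generalize t 2 = z at *
  push_cast
  simp only [Fintype.sum_prod_type]
  have sum_last (a b : Fin q) (hab : b ≠ a) :
      ∑ c : Fin q, (if c ≠ a ∧ c ≠ b ∧ c ≠ z then (1 : ℤ) else 0) =
        q - 3 + (if a = z then 1 else 0) + (if b = z then 1 else 0) := by
    have (c : Fin q) : (if c ≠ a ∧ c ≠ b ∧ c ≠ z then (1 : ℤ) else 0) =
        1 - (if c = a then 1 else 0) - (if c = b then 1 else 0) -
          (if c = z then 1 - (if a = z then 1 else 0) - (if b = z then 1 else 0) else 0) := by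
      grind
    simp only [this, Finset.sum_sub_distrib, Finset.sum_ite_eq', Finset.mem_univ, if_true,
      Finset.sum_const, Finset.card_univ, Fintype.card_fin, nsmul_eq_mul]
    ring
  have sum_middle (a : Fin q) :
      ∑ b : Fin q, (if b ≠ a ∧ b ≠ y then
        (q : ℤ) - 3 + (if a = z then 1 else 0) + (if b = z then 1 else 0) else 0) =
        (q - 2) * (q - 3) + 1 + (if a = y then (q : ℤ) - 3 else 0) +
          (if a = z then (q : ℤ) - 3 else 0) := by
    have (b : Fin q) : (if b ≠ a ∧ b ≠ y then
        (q : ℤ) - 3 + (if a = z then 1 else 0) + (if b = z then 1 else 0) else 0) =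
        ((q : ℤ) - 3 + (if a = z then 1 else 0)) -
          (if b = a then (q : ℤ) - 3 + (if a = z then 1 else 0) else 0) -
          (if b = y then (if a = y then 0 else (q : ℤ) - 3 + (if a = z then 1 else 0)) else 0) +
          (if b = z then (if a = z then 0 else 1) else 0) := by
      grind
    simp only [this, Finset.sum_sub_distrib, Finset.sum_add_distrib, Finset.sum_ite_eq',
      Finset.mem_univ, if_true, Finset.sum_const, Finset.card_univ, Fintype.card_fin,
      nsmul_eq_mul]
    grind
  have sum_first :
      ∑ a : Fin q, (if a ≠ x then
        ((q : ℤ) - 2) * (q - 3) + 1 + (if a = y then (q : ℤ) - 3 else 0) +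
          (if a = z then (q : ℤ) - 3 else 0) else 0) =
        (q : ℤ) ^ 3 - 6 * (q : ℤ) ^ 2 + 14 * (q : ℤ) - 13 := by
    have (a : Fin q) : (if a ≠ x then
        ((q : ℤ) - 2) * (q - 3) + 1 + (if a = y then (q : ℤ) - 3 else 0) +
          (if a = z then (q : ℤ) - 3 else 0) else 0) =
        (((q : ℤ) - 2) * (q - 3) + 1) - (if a = x then ((q : ℤ) - 2) * (q - 3) + 1 else 0) +
          (if a = y then (q : ℤ) - 3 else 0) + (if a = z then (q : ℤ) - 3 else 0) := by
      grind
    simp only [this, Finset.sum_sub_distrib, Finset.sum_add_distrib, Finset.sum_ite_eq',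
      Finset.mem_univ, if_true, Finset.sum_const, Finset.card_univ, Fintype.card_fin,
      nsmul_eq_mul]
    ring
  rw [← sum_first]
  refine Finset.sum_congr rfl fun a _ => ?_
  by_cases hx : a ≠ x
  · rw [if_pos hx, ← sum_middle a]
    refine Finset.sum_congr rfl fun b _ => ?_
    by_cases hb : b ≠ a ∧ b ≠ y
    · rw [if_pos hb, ← sum_last a b hb.1]
      simp only [hx, hb, ne_eq, not_false_eq_true, true_and]
    · simp only [hb, false_and, and_false, if_false, Finset.sum_const_zero]
  · simp only [hx, false_and, if_false, Finset.sum_const_zero]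

/-- Colorings of `C₃ □ Pₙ` are sequences of injective triples, consecutive ones differing in every
coordinate. -/
def boxProdColoringEquivChain (q m : ℕ) :
    {f : Fin 3 × Fin (m + 1) → Fin q //
      ∀ a b, ((SimpleGraph.cycleGraph 3).boxProd (SimpleGraph.pathGraph (m + 1))).Adj a b →
        f a ≠ f b} ≃
    {g : Fin (m + 1) → (Fin 3 ↪ Fin q) //
      ∀ i : Fin m, ∀ k, g i.castSucc k ≠ g i.succ k} where
  toFun f := ⟨fun j => ⟨fun k => f.1 (k, j), fun k l hkl => by
      by_contra hne
      refine f.2 (k, j) (l, j) (Or.inl ⟨?_, rfl⟩) hkl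
      rw [SimpleGraph.cycleGraph_three_eq_top]
      exact hne⟩,
    fun i k => f.2 _ _ (Or.inr ⟨SimpleGraph.pathGraph_adj.2 (Or.inl rfl), rfl⟩)⟩
  invFun g := ⟨fun p => g.1 p.2 p.1, by
    rintro ⟨k, i⟩ ⟨l, j⟩ (⟨hadj, hij⟩ | ⟨hadj, hkl⟩)
    · dsimp only at hadj hij ⊢
      subst hij
      exact (g.1 i).injective.ne hadj.ne
    · dsimp only at hadj hkl ⊢
      subst hkl
      rcases SimpleGraph.pathGraph_adj.1 hadj with h | h
      · have hj : j = Fin.succ ⟨i, by omega⟩ := Fin.ext h.symm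
        rw [hj]
        exact g.2 ⟨i, by omega⟩ k
      · have hi : i = Fin.succ ⟨j, by omega⟩ := Fin.ext h.symm
        rw [hi]
        exact (g.2 ⟨j, by omega⟩ k).symm⟩
  left_inv _ := rfl
  right_inv _ := rfl

/-- The number of proper `q`-colorings of the `3 × n` square-lattice strip with periodic
transverse boundary conditions (the box product `C₃ □ Pₙ`) equals
`q (q-1) (q-2) (q³ - 6q² + 14q - 13)^{n-1}`. -/
theorem chromatic_polynomial_square_strip_3P
    (q n : ℕ) (hn : 1 ≤ n) :
    (Nat.card {f : Fin 3 × Fin n → Fin q //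
        ∀ a b, ((SimpleGraph.cycleGraph 3).boxProd (SimpleGraph.pathGraph n)).Adj a b →
          f a ≠ f b} : ℤ) =
      (q : ℤ) * ((q : ℤ) - 1) * ((q : ℤ) - 2) *
        ((q : ℤ) ^ 3 - 6 * (q : ℤ) ^ 2 + 14 * (q : ℤ) - 13) ^ (n - 1) := by
  obtain ⟨m, rfl⟩ := Nat.exists_eq_add_of_le' hn
  rw [Nat.card_congr (boxProdColoringEquivChain q m),
    card_chains_of_card_predecessors (fun s t : Fin 3 ↪ Fin q => ∀ k, s k ≠ t k) _
      card_embedding_fin_three_forall_ne, Nat.add_sub_cancel]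
  congr 1
  rw [Nat.card_eq_fintype_card, Fintype.card_embedding_eq, Fintype.card_fin, Fintype.card_fin]
  match q with
  | 0 => rfl
  | 1 => rfl
  | q + 2 =>
    simp only [Nat.succ_descFactorial_succ, Nat.descFactorial_one]
    push_cast
    ring
end

section
/- Let q and n be natural numbers with n ≥ 1, and let G be the 4×n square-lattice strip with periodic transverse boundary conditions, i.e. the box product of the cycle graph on 4 vertices with the path graph on n vertices. Let T be the 2×2 integer matrix T = [[q⁴−8q³+28q²−51q+41, 2q³−12q²+28q−24],[2q−5, q²−4q+5]] (with q cast to ℤ). Then the number of proper q-colorings of G equals q·(q−1)·(uᵀ·T^{n−1}·v), where u is the column vector (q²−3q+3, 2q−2) and v is the column vector (1, 0). -/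
open Matrix

/-- A sum over `Fin (n + 1) → α` splits off the first coordinate. -/
lemma sum_fin_succ_arrow {α M : Type*} [Fintype α] [AddCommMonoid M] {n : ℕ}
    (F : (Fin (n + 1) → α) → M) :
    ∑ g, F g = ∑ a, ∑ g : Fin n → α, F (Fin.cons a g) := by
  rw [← Fintype.sum_prod_type' (f := fun a (g : Fin n → α) => F (Fin.cons a g))]
  exact (Fintype.sum_equiv (Fin.consEquiv fun _ => α) _ _ fun _ => rfl).symm

/-- Total weight of the chains of `n + 1` states starting at a given state, with vertex weights `P`
and transition weights `R`. -/
def chainWeight {α : Type*} [Fintype α] (P : α → ℤ) (R : α → α → ℤ) : ℕ → α → ℤ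
  | 0, a => P a
  | n + 1, a => P a * ∑ b, R a b * chainWeight P R n b

lemma sum_cons_eq_chainWeight {α : Type*} [Fintype α] (P : α → ℤ) (R : α → α → ℤ) (n : ℕ) (a : α) :
    ∑ g : Fin n → α, (∏ i, P ((Fin.cons a g : Fin (n + 1) → α) i)) *
      ∏ i : Fin n, R ((Fin.cons a g : Fin (n + 1) → α) i.castSucc) (g i) = chainWeight P R n a := by
  induction n generalizing a with
  | zero => simp [chainWeight]
  | succ n ih =>
    rw [sum_fin_succ_arrow, chainWeight, Finset.mul_sum]
    refine Finset.sum_congr rfl fun b _ => ?_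
    rw [← ih b, Finset.mul_sum, Finset.mul_sum]
    refine Finset.sum_congr rfl fun g _ => ?_
    rw [Fin.prod_univ_succ, Fin.prod_univ_succ (n := n) (f := fun i : Fin (n + 1) => R _ _)]
    simp only [Fin.cons_zero, Fin.cons_succ, Fin.castSucc_zero, ← Fin.succ_castSucc]
    ring

lemma sum_eq_sum_chainWeight {α : Type*} [Fintype α] (P : α → ℤ) (R : α → α → ℤ) (n : ℕ) :
    ∑ g : Fin (n + 1) → α, (∏ i, P (g i)) * ∏ i : Fin n, R (g i.castSucc) (g i.succ) =
      ∑ a, chainWeight P R n a := by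
  rw [sum_fin_succ_arrow]
  refine Finset.sum_congr rfl fun a _ => ?_
  simp only [← sum_cons_eq_chainWeight, Fin.cons_succ]

lemma sum_fin_four_arrow {α M : Type*} [Fintype α] [AddCommMonoid M] (F : (Fin 4 → α) → M) :
    ∑ g, F g = ∑ a, ∑ b, ∑ c, ∑ d, F ![a, b, c, d] := by
  simp only [sum_fin_succ_arrow, Fintype.sum_unique]
  refine Finset.sum_congr rfl fun a _ => Finset.sum_congr rfl fun b _ =>
    Finset.sum_congr rfl fun c _ => Finset.sum_congr rfl fun d _ => ?_
  congr 1

/-- The sum of a function that is constant off a finset. -/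
lemma sum_eq_of_const_off {α : Type*} [Fintype α] [DecidableEq α] (S : Finset α) (f : α → ℤ) (c : ℤ)
    (h : ∀ x, x ∉ S → f x = c) :
    ∑ x, f x = ∑ x ∈ S, f x + (Fintype.card α - S.card) * c := by
  rw [← Finset.sum_add_sum_compl S f, Finset.sum_congr rfl
    (fun x hx => h x (Finset.mem_compl.mp hx)), Finset.sum_const, Finset.card_compl, nsmul_eq_mul,
    Nat.cast_sub (Finset.card_le_univ S)]

/-- The indicator of `x ≠ y`. -/
def neInd {α : Type*} [DecidableEq α] (x y : α) : ℤ := if x = y then 0 else 1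

lemma neInd_comm {α : Type*} [DecidableEq α] (x y : α) : neInd x y = neInd y x := by
  simp only [neInd, eq_comm]

/-- The number of colors different from three given colors. -/
def colorsAvoiding {α : Type*} [Fintype α] [DecidableEq α] (x y z : α) : ℤ :=
  ∑ w, neInd x w * neInd w y * neInd z w

lemma colorsAvoiding_eq {α : Type*} [Fintype α] [DecidableEq α] (x y z : α) :
    colorsAvoiding x y z = if x = y then (if z = x then (Fintype.card α : ℤ) - 1
      else Fintype.card α - 2) else if z = x ∨ z = y then Fintype.card α - 2
      else Fintype.card α - 3 := by
  unfold colorsAvoiding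
  rw [sum_eq_of_const_off {x, y, z} _ 1]
  · by_cases hxy : x = y <;> by_cases hzx : z = x <;> by_cases hzy : z = y <;>
      simp_all [neInd, Finset.sum_insert, Finset.card_insert_of_notMem, eq_comm]
  · intro w hw
    simp only [Finset.mem_insert, Finset.mem_singleton, not_or] at hw
    simp [neInd, hw, Ne.symm hw.1, Ne.symm hw.2.2]

/-- The number of proper colorings of a layer compatible with the adjacent layer `d₀, d₁, d₂, d₃`,
weighted by `w` of the colors of two opposite vertices. -/
lemma sum_layer_eq {α : Type*} [Fintype α] [DecidableEq α] (w : α → α → ℤ) (d₀ d₁ d₂ d₃ : α) :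
    ∑ a, ∑ b, ∑ c, ∑ d, (neInd d₀ a * neInd d₁ b * neInd d₂ c * neInd d₃ d) *
      (neInd a b * neInd b c * neInd c d * neInd d a * w a c) =
    ∑ a, ∑ c, neInd d₀ a * neInd d₂ c * w a c * colorsAvoiding a c d₁ * colorsAvoiding a c d₃ := by
  refine Finset.sum_congr rfl fun a _ => ?_
  rw [Finset.sum_comm]
  refine Finset.sum_congr rfl fun c _ => ?_
  rw [mul_assoc, colorsAvoiding, colorsAvoiding, Finset.sum_mul_sum, Finset.mul_sum]
  refine Finset.sum_congr rfl fun b _ => ?_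
  rw [Finset.mul_sum]
  refine Finset.sum_congr rfl fun d _ => ?_
  rw [neInd_comm a d, neInd_comm d c]
  ring

lemma sum_layer_diag {α : Type*} [Fintype α] [DecidableEq α] (d₀ d₁ d₂ d₃ : α)
    (h₀₁ : d₀ ≠ d₁) (h₁₂ : d₁ ≠ d₂) (h₂₃ : d₂ ≠ d₃) (h₃₀ : d₃ ≠ d₀) :
    ∑ a, neInd d₀ a * neInd d₂ a * colorsAvoiding a a d₁ * colorsAvoiding a a d₃ =
     ((Fintype.card α : ℤ) - 2) ^ 3 + (if d₀ = d₂ then ((Fintype.card α : ℤ) - 2) ^ 2 else 0)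
      + 2 * (Fintype.card α - 2) + (if d₁ = d₃ then 1 else 0) := by
  rw [sum_eq_of_const_off {d₀, d₁, d₂, d₃} _ (((Fintype.card α : ℤ) - 2) ^ 2)]
  · by_cases h₀₂ : d₀ = d₂ <;> by_cases h₁₃ : d₁ = d₃ <;>
      simp_all [neInd, colorsAvoiding_eq, Finset.sum_insert, Finset.card_insert_of_notMem, eq_comm] <;>
      ring
  · intro w hw
    simp only [Finset.mem_insert, Finset.mem_singleton, not_or] at hw
    obtain ⟨h0, h1, h2, h3⟩ := hw
    simp [neInd, colorsAvoiding_eq, Ne.symm h0, Ne.symm h1, Ne.symm h2, Ne.symm h3]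
    ring

lemma sum_colorsAvoiding_right {α : Type*} [Fintype α] [DecidableEq α] (a d₁ d₂ d₃ : α) :
    ∑ c, neInd d₂ c * 1 * colorsAvoiding a c d₁ * colorsAvoiding a c d₃ =
      ∑ c ∈ {a, d₁, d₂, d₃}, neInd d₂ c * 1 * colorsAvoiding a c d₁ * colorsAvoiding a c d₃ +
      (Fintype.card α - (({a, d₁, d₂, d₃} : Finset α).card : ℤ)) *
      ((Fintype.card α - 3 + (if a = d₁ then 1 else 0)) *
        (Fintype.card α - 3 + (if a = d₃ then 1 else 0))) := by
  apply sum_eq_of_const_off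
  intro w hw
  simp only [Finset.mem_insert, Finset.mem_singleton, not_or] at hw
  obtain ⟨h0, h1, h2, h3⟩ := hw
  simp only [neInd, colorsAvoiding_eq, Ne.symm h0, Ne.symm h1, Ne.symm h2, Ne.symm h3, if_false,
    or_false, eq_comm (a := a)]
  split_ifs <;> ring

lemma sum_layer_one {α : Type*} [Fintype α] [DecidableEq α] (d₀ d₁ d₂ d₃ : α)
    (h₀₁ : d₀ ≠ d₁) (h₁₂ : d₁ ≠ d₂) (h₂₃ : d₂ ≠ d₃) (h₃₀ : d₃ ≠ d₀) :
    ∑ a, neInd d₀ a * ∑ c, neInd d₂ c * 1 * colorsAvoiding a c d₁ * colorsAvoiding a c d₃ =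
      (Fintype.card α : ℤ) ^ 4 - 8 * (Fintype.card α : ℤ) ^ 3 + 28 * (Fintype.card α : ℤ) ^ 2
        - 51 * Fintype.card α + 41 + (2 * Fintype.card α - 5) *
          ((if d₀ = d₂ then 1 else 0) + (if d₁ = d₃ then 1 else 0)) := by
  simp only [sum_colorsAvoiding_right _ d₁ d₂ d₃]
  generalize hF : (fun a : α => neInd d₀ a * (∑ c ∈ {a, d₁, d₂, d₃},
      neInd d₂ c * 1 * colorsAvoiding a c d₁ * colorsAvoiding a c d₃ +
      (Fintype.card α - (({a, d₁, d₂, d₃} : Finset α).card : ℤ)) *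
      ((Fintype.card α - 3 + (if a = d₁ then 1 else 0)) *
        (Fintype.card α - 3 + (if a = d₃ then 1 else 0))))) = F
  have hx : ∀ x, x ∉ ({d₀, d₁, d₂, d₃} : Finset α) → F x =
      if d₁ = d₃ then ((Fintype.card α : ℤ) - 2) ^ 2 + (Fintype.card α - 2) ^ 2 +
        (Fintype.card α - 3) ^ 3
      else ((Fintype.card α : ℤ) - 2) ^ 2 + 2 * (Fintype.card α - 2) * (Fintype.card α - 3) +
        (Fintype.card α - 4) * (Fintype.card α - 3) ^ 2 := by
    intro w hw
    simp only [Finset.mem_insert, Finset.mem_singleton, not_or] at hw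
    obtain ⟨h0, h1, h2, h3⟩ := hw
    subst hF
    by_cases h₁₃ : d₁ = d₃
    · subst h₁₃
      simp [neInd, colorsAvoiding_eq, Ne.symm h0, Ne.symm h1, Ne.symm h2, h1, h2, h₁₂, h₂₃,
        Finset.sum_insert, Finset.card_insert_of_notMem]
      ring
    · simp [neInd, colorsAvoiding_eq, Ne.symm h0, Ne.symm h1, Ne.symm h2, Ne.symm h3, h1, h2, h3,
        h₁₂, h₂₃, h₁₂.symm, h₂₃.symm, h₁₃, Ne.symm h₁₃, Finset.sum_insert,
        Finset.card_insert_of_notMem]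
      ring
  have key := sum_eq_of_const_off _ F _ hx
  subst hF
  rw [key]
  by_cases h₀₂ : d₀ = d₂ <;> by_cases h₁₃ : d₁ = d₃
  · subst h₀₂ h₁₃
    simp [neInd, colorsAvoiding_eq, h₀₁, h₀₁.symm, Finset.sum_insert, Finset.card_insert_of_notMem]
    ring
  · subst h₀₂
    simp [neInd, colorsAvoiding_eq, h₀₁, h₀₁.symm, h₃₀, h₃₀.symm, h₁₃, Ne.symm h₁₃,
      Finset.sum_insert, Finset.card_insert_of_notMem]
    ring
  · subst h₁₃
    simp [neInd, colorsAvoiding_eq, h₀₁, h₁₂, h₁₂.symm, h₀₂,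
      Finset.sum_insert, Finset.card_insert_of_notMem]
    ring
  · simp [neInd, colorsAvoiding_eq, h₀₁, h₁₂, h₁₂.symm, h₂₃, h₂₃.symm, h₃₀.symm,
      h₀₂, h₁₃, Ne.symm h₁₃, Finset.sum_insert, Finset.card_insert_of_notMem]
    ring

/-- The indicator of proper colorings of the 4-cycle. -/
def cycleWeight {α : Type*} [DecidableEq α] (c : Fin 4 → α) : ℤ :=
  neInd (c 0) (c 1) * neInd (c 1) (c 2) * neInd (c 2) (c 3) * neInd (c 3) (c 0)

/-- The indicator that two colorings of a layer disagree everywhere. -/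
def layerWeight {α : Type*} [DecidableEq α] (d c : Fin 4 → α) : ℤ :=
  neInd (d 0) (c 0) * neInd (d 1) (c 1) * neInd (d 2) (c 2) * neInd (d 3) (c 3)

/-- The number of pairs of opposite vertices of the 4-cycle with equal colors. -/
def oppositeCount {α : Type*} [DecidableEq α] (c : Fin 4 → α) : ℤ :=
  (if c 0 = c 2 then 1 else 0) + (if c 1 = c 3 then 1 else 0)

lemma cycleWeight_eq_zero_or {α : Type*} [DecidableEq α] (c : Fin 4 → α) :
    cycleWeight c = 0 ∨ c 0 ≠ c 1 ∧ c 1 ≠ c 2 ∧ c 2 ≠ c 3 ∧ c 3 ≠ c 0 := by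
  simp only [cycleWeight, neInd, mul_eq_zero]
  grind

lemma sum_layerWeight {α : Type*} [Fintype α] [DecidableEq α] (d : Fin 4 → α)
    (h₀₁ : d 0 ≠ d 1) (h₁₂ : d 1 ≠ d 2) (h₂₃ : d 2 ≠ d 3) (h₃₀ : d 3 ≠ d 0) :
    ∑ c, layerWeight d c * cycleWeight c =
      (Fintype.card α : ℤ) ^ 4 - 8 * (Fintype.card α : ℤ) ^ 3 + 28 * (Fintype.card α : ℤ) ^ 2
        - 51 * Fintype.card α + 41 + (2 * Fintype.card α - 5) * oppositeCount d := by
  rw [oppositeCount, ← sum_layer_one _ _ _ _ h₀₁ h₁₂ h₂₃ h₃₀, sum_fin_four_arrow]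
  have h := sum_layer_eq (fun _ _ => 1) (d 0) (d 1) (d 2) (d 3)
  simp only [Finset.mul_sum, mul_assoc, mul_one] at h ⊢
  rw [← h]
  simp [layerWeight, cycleWeight, mul_assoc]

lemma sum_layer_ite {α : Type*} [Fintype α] [DecidableEq α] (d₀ d₁ d₂ d₃ : α)
    (h₀₁ : d₀ ≠ d₁) (h₁₂ : d₁ ≠ d₂) (h₂₃ : d₂ ≠ d₃) (h₃₀ : d₃ ≠ d₀) :
    ∑ a, ∑ b, ∑ c, ∑ d, (neInd d₀ a * neInd d₁ b * neInd d₂ c * neInd d₃ d) *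
      (neInd a b * neInd b c * neInd c d * neInd d a * if a = c then 1 else 0) =
     ((Fintype.card α : ℤ) - 2) ^ 3 + (if d₀ = d₂ then ((Fintype.card α : ℤ) - 2) ^ 2 else 0)
      + 2 * (Fintype.card α - 2) + (if d₁ = d₃ then 1 else 0) := by
  rw [← sum_layer_diag d₀ d₁ d₂ d₃ h₀₁ h₁₂ h₂₃ h₃₀,
    sum_layer_eq (fun a c => if a = c then 1 else 0)]
  simp [mul_ite, ite_mul]

lemma sum_layerWeight_mul_oppositeCount {α : Type*} [Fintype α] [DecidableEq α] (d : Fin 4 → α)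
    (h₀₁ : d 0 ≠ d 1) (h₁₂ : d 1 ≠ d 2) (h₂₃ : d 2 ≠ d 3) (h₃₀ : d 3 ≠ d 0) :
    ∑ c, layerWeight d c * (cycleWeight c * oppositeCount c) =
      2 * (Fintype.card α : ℤ) ^ 3 - 12 * (Fintype.card α : ℤ) ^ 2 + 28 * Fintype.card α - 24 +
        ((Fintype.card α : ℤ) ^ 2 - 4 * Fintype.card α + 5) * oppositeCount d := by
  have h := sum_layer_ite _ _ _ _ h₀₁ h₁₂ h₂₃ h₃₀
  have h' := sum_layer_ite _ _ _ _ h₁₂ h₂₃ h₃₀ h₀₁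
  have hrot : ∑ a, ∑ b, ∑ c, ∑ e, (neInd (d 0) a * neInd (d 1) b * neInd (d 2) c * neInd (d 3) e) *
      (neInd a b * neInd b c * neInd c e * neInd e a * if b = e then 1 else 0) =
      ∑ b, ∑ c, ∑ e, ∑ a, (neInd (d 1) b * neInd (d 2) c * neInd (d 3) e * neInd (d 0) a) *
      (neInd b c * neInd c e * neInd e a * neInd a b * if b = e then 1 else 0) := by
    rw [Finset.sum_comm]
    refine Finset.sum_congr rfl fun b _ => ?_
    rw [Finset.sum_comm]
    refine Finset.sum_congr rfl fun c _ => ?_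
    rw [Finset.sum_comm]
    refine Finset.sum_congr rfl fun e _ => Finset.sum_congr rfl fun a _ => ?_
    ring
  have hsplit : ∑ c, layerWeight d c * (cycleWeight c * oppositeCount c) =
      ∑ a, ∑ b, ∑ c, ∑ e, (neInd (d 0) a * neInd (d 1) b * neInd (d 2) c * neInd (d 3) e) *
        (neInd a b * neInd b c * neInd c e * neInd e a * if a = c then 1 else 0) +
      ∑ a, ∑ b, ∑ c, ∑ e, (neInd (d 0) a * neInd (d 1) b * neInd (d 2) c * neInd (d 3) e) *
        (neInd a b * neInd b c * neInd c e * neInd e a * if b = e then 1 else 0) := by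
    simp only [sum_fin_four_arrow, ← Finset.sum_add_distrib, ← mul_add]
    rfl
  rw [hsplit, hrot, h, h', oppositeCount]
  simp only [eq_comm (a := d 2) (b := d 0)]
  split_ifs <;> ring

lemma sum_cycle_eq {α : Type*} [Fintype α] [DecidableEq α] (w : α → α → ℤ) :
    ∑ a, ∑ b, ∑ c, ∑ d, neInd a b * neInd b c * neInd c d * neInd d a * w a c =
    ∑ a, ∑ c : α, w a c * (colorsAvoiding a c a * colorsAvoiding a c a) := by
  have hidem (x y : α) : neInd x y * neInd x y = neInd x y := by simp [neInd]
  refine Finset.sum_congr rfl fun a _ => ?_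
  rw [Finset.sum_comm]
  refine Finset.sum_congr rfl fun c _ => ?_
  rw [colorsAvoiding, Finset.sum_mul_sum, Finset.mul_sum]
  refine Finset.sum_congr rfl fun b _ => ?_
  rw [Finset.mul_sum]
  refine Finset.sum_congr rfl fun d _ => ?_
  rw [neInd_comm c d, neInd_comm d a]
  linear_combination -(w a c * neInd b c * neInd d c * neInd a d * neInd a d) * hidem a b -
    w a c * neInd b c * neInd d c * neInd a b * hidem a d

lemma sum_cycleWeight {α : Type*} [Fintype α] [DecidableEq α] :
    ∑ c : Fin 4 → α, cycleWeight c = (Fintype.card α : ℤ) * (Fintype.card α - 1) *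
      ((Fintype.card α : ℤ) ^ 2 - 3 * Fintype.card α + 3) := by
  have h := sum_cycle_eq (α := α) (fun _ _ => 1)
  have hrow (a : α) : ∑ c, colorsAvoiding a c a * colorsAvoiding a c a =
      ((Fintype.card α : ℤ) - 1) * ((Fintype.card α : ℤ) ^ 2 - 3 * Fintype.card α + 3) := by
    rw [sum_eq_of_const_off {a} _ (((Fintype.card α : ℤ) - 2) ^ 2)]
    · simp [colorsAvoiding_eq]
      ring
    · intro x hx
      simp [colorsAvoiding_eq, Ne.symm (Finset.notMem_singleton.mp hx)]
      ring
  simp only [one_mul, mul_one, hrow, Finset.sum_const, Finset.card_univ, nsmul_eq_mul] at h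
  rw [sum_fin_four_arrow, mul_assoc, ← h]
  rfl

lemma sum_cycleWeight_mul_oppositeCount {α : Type*} [Fintype α] [DecidableEq α] :
    ∑ c : Fin 4 → α, cycleWeight c * oppositeCount c =
      (Fintype.card α : ℤ) * (Fintype.card α - 1) * (2 * Fintype.card α - 2) := by
  have h := sum_cycle_eq (α := α) (fun a c => if a = c then 1 else 0)
  have hrot : ∑ a : α, ∑ b, ∑ c, ∑ e,
      neInd a b * neInd b c * neInd c e * neInd e a * (if b = e then 1 else 0) =
      ∑ b : α, ∑ c, ∑ e, ∑ a,
        neInd b c * neInd c e * neInd e a * neInd a b * if b = e then 1 else 0 := by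
    rw [Finset.sum_comm]
    refine Finset.sum_congr rfl fun b _ => ?_
    rw [Finset.sum_comm]
    refine Finset.sum_congr rfl fun c _ => ?_
    rw [Finset.sum_comm]
    refine Finset.sum_congr rfl fun e _ => Finset.sum_congr rfl fun a _ => ?_
    ring
  have hsplit : ∑ c : Fin 4 → α, cycleWeight c * oppositeCount c =
      ∑ a : α, ∑ b, ∑ c, ∑ e,
        neInd a b * neInd b c * neInd c e * neInd e a * (if a = c then 1 else 0) +
      ∑ a : α, ∑ b, ∑ c, ∑ e,
        neInd a b * neInd b c * neInd c e * neInd e a * (if b = e then 1 else 0) := by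
    simp only [sum_fin_four_arrow, ← Finset.sum_add_distrib, ← mul_add]
    rfl
  rw [hsplit, hrot, h]
  simp only [ite_mul, one_mul, zero_mul, Finset.sum_ite_eq, Finset.mem_univ, if_true,
    colorsAvoiding_eq, Finset.sum_const, Finset.card_univ, nsmul_eq_mul]
  ring

/-- The transfer matrix of the square-lattice strip of width 4 with periodic transverse boundary
conditions. -/
def stripTransfer (q : ℤ) : Matrix (Fin 2) (Fin 2) ℤ :=
  !![q ^ 4 - 8 * q ^ 3 + 28 * q ^ 2 - 51 * q + 41, 2 * q ^ 3 - 12 * q ^ 2 + 28 * q - 24;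
    2 * q - 5, q ^ 2 - 4 * q + 5]

lemma chainWeight_layer {α : Type*} [Fintype α] [DecidableEq α] (n : ℕ) (d : Fin 4 → α) :
    chainWeight cycleWeight layerWeight n d = cycleWeight d *
      (((stripTransfer (Fintype.card α) ^ n).mulVec ![1, 0]) 0 +
        ((stripTransfer (Fintype.card α) ^ n).mulVec ![1, 0]) 1 * oppositeCount d) := by
  induction n generalizing d with
  | zero => simp [chainWeight]
  | succ n ih =>
    rw [chainWeight]
    obtain h | ⟨h₀₁, h₁₂, h₂₃, h₃₀⟩ := cycleWeight_eq_zero_or d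
    · simp [h]
    congr 1
    rw [pow_succ', ← Matrix.mulVec_mulVec]
    simp only [ih]
    generalize (stripTransfer (Fintype.card α) ^ n).mulVec ![1, 0] = x
    have h : ∑ c, layerWeight d c * (cycleWeight c * (x 0 + x 1 * oppositeCount c)) =
        x 0 * ∑ c, layerWeight d c * cycleWeight c +
          x 1 * ∑ c, layerWeight d c * (cycleWeight c * oppositeCount c) := by
      rw [Finset.mul_sum, Finset.mul_sum, ← Finset.sum_add_distrib]
      exact Finset.sum_congr rfl fun c _ => by ring
    rw [h, sum_layerWeight d h₀₁ h₁₂ h₂₃ h₃₀, sum_layerWeight_mul_oppositeCount d h₀₁ h₁₂ h₂₃ h₃₀]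
    simp only [stripTransfer, Matrix.mulVec, dotProduct, Fin.sum_univ_two, Matrix.of_apply,
      Matrix.cons_val_zero, Matrix.cons_val_one]
    ring

lemma cycleWeight_eq_ite {α : Type*} [DecidableEq α] (c : Fin 4 → α) :
    cycleWeight c = if c 0 ≠ c 1 ∧ c 1 ≠ c 2 ∧ c 2 ≠ c 3 ∧ c 3 ≠ c 0 then 1 else 0 := by
  simp only [cycleWeight, neInd]
  grind

lemma layerWeight_eq_ite {α : Type*} [DecidableEq α] (d c : Fin 4 → α) :
    layerWeight d c = if ∀ k, d k ≠ c k then 1 else 0 := by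
  simp only [layerWeight, neInd, Fin.forall_fin_succ, IsEmpty.forall_iff]
  simp only [Fin.reduceSucc, and_true]
  grind

lemma proper_strip_iff {α : Type*} (n : ℕ) (f : Fin 4 × Fin (n + 1) → α) :
    (∀ a b, ((SimpleGraph.cycleGraph 4).boxProd (SimpleGraph.pathGraph (n + 1))).Adj a b →
      f a ≠ f b) ↔
    (∀ i, f (0, i) ≠ f (1, i) ∧ f (1, i) ≠ f (2, i) ∧ f (2, i) ≠ f (3, i) ∧ f (3, i) ≠ f (0, i)) ∧
      ∀ (i : Fin n) (k : Fin 4), f (k, i.castSucc) ≠ f (k, i.succ) := by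
  constructor
  · intro h
    refine ⟨fun i => ⟨?_, ?_, ?_, ?_⟩, fun i k => ?_⟩
    iterate 4
      refine h _ _ (SimpleGraph.boxProd_adj.mpr (Or.inl ⟨?_, rfl⟩))
      simp only [SimpleGraph.cycleGraph_adj]
      decide
    exact h _ _ (SimpleGraph.boxProd_adj.mpr (Or.inr
      ⟨SimpleGraph.pathGraph_adj.mpr (Or.inl (by simp)), rfl⟩))
  · rintro ⟨hc, hp⟩ ⟨k, i⟩ ⟨l, j⟩ hadj
    rw [SimpleGraph.boxProd_adj] at hadj
    obtain ⟨hkl, hij⟩ | ⟨hij, hkl⟩ := hadj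
    · obtain rfl : i = j := hij
      obtain ⟨h0, h1, h2, h3⟩ := hc i
      simp only [SimpleGraph.cycleGraph_adj] at hkl
      fin_cases k <;> fin_cases l <;>
        first
        | exact absurd hkl (by decide)
        | assumption
        | (apply Ne.symm; assumption)
    · obtain rfl : k = l := hkl
      rw [SimpleGraph.pathGraph_adj] at hij
      have key (i j : Fin (n + 1)) (h : i.val + 1 = j.val) : f (k, i) ≠ f (k, j) := by
        have hi : i.val < n := by omega
        have := hp ⟨i, hi⟩ k
        rwa [show Fin.castSucc ⟨i, hi⟩ = i from rfl,
          show Fin.succ ⟨i, hi⟩ = j from Fin.ext h] at this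
      exact hij.elim (key i j) fun h => (key j i h).symm

lemma card_strip_colorings {α : Type*} [Fintype α] [DecidableEq α] (n : ℕ) :
    (Nat.card {f : Fin 4 × Fin (n + 1) → α //
      ∀ a b, ((SimpleGraph.cycleGraph 4).boxProd (SimpleGraph.pathGraph (n + 1))).Adj a b →
        f a ≠ f b} : ℤ) = ∑ c : Fin 4 → α, chainWeight cycleWeight layerWeight n c := by
  let e : (Fin 4 × Fin (n + 1) → α) ≃ (Fin (n + 1) → Fin 4 → α) :=
    ⟨fun f i k => f (k, i), fun g p => g p.2 p.1, fun _ => rfl, fun _ => rfl⟩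
  rw [Nat.card_congr (e.subtypeEquiv (q := fun g =>
    (∀ i, g i 0 ≠ g i 1 ∧ g i 1 ≠ g i 2 ∧ g i 2 ≠ g i 3 ∧ g i 3 ≠ g i 0) ∧
      ∀ (i : Fin n) (k : Fin 4), g i.castSucc k ≠ g i.succ k) (proper_strip_iff n)),
    Nat.card_eq_fintype_card, Fintype.card_subtype, Finset.card_filter, ← sum_eq_sum_chainWeight]
  push_cast
  refine Finset.sum_congr rfl fun g _ => ?_
  simp only [cycleWeight_eq_ite, layerWeight_eq_ite, Finset.prod_ite_zero, Finset.prod_const_one,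
    Finset.mem_univ, true_imp_iff]
  split_ifs <;> simp_all

/-- Transfer-matrix formula for the chromatic polynomial of the `4 × n` square-lattice strip
with periodic transverse boundary conditions (`C₄ □ Pₙ`): the number of proper `q`-colorings
equals `q (q-1) · uᵀ T^{n-1} v` with the indicated `2 × 2` transfer matrix `T` and vectors
`u = (q² - 3q + 3, 2q - 2)`, `v = (1, 0)`. -/
theorem chromatic_polynomial_square_strip_4P
    (q n : ℕ) (hn : 1 ≤ n) :
    (Nat.card {f : Fin 4 × Fin n → Fin q //
        ∀ a b, ((SimpleGraph.cycleGraph 4).boxProd (SimpleGraph.pathGraph n)).Adj a b →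
          f a ≠ f b} : ℤ) =
      (q : ℤ) * ((q : ℤ) - 1) *
        (![(q : ℤ)^2 - 3*(q : ℤ) + 3, 2*(q : ℤ) - 2] ⬝ᵥ
          ((!![(q : ℤ)^4 - 8*(q : ℤ)^3 + 28*(q : ℤ)^2 - 51*(q : ℤ) + 41,
               2*(q : ℤ)^3 - 12*(q : ℤ)^2 + 28*(q : ℤ) - 24;
               2*(q : ℤ) - 5, (q : ℤ)^2 - 4*(q : ℤ) + 5]) ^ (n - 1)).mulVec ![1, 0]) := by
  obtain ⟨n, rfl⟩ := Nat.exists_eq_add_of_le' hn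
  have h : ∑ c : Fin 4 → Fin q, chainWeight cycleWeight layerWeight n c =
      ((stripTransfer q ^ n).mulVec ![1, 0]) 0 * ∑ c : Fin 4 → Fin q, cycleWeight c +
        ((stripTransfer q ^ n).mulVec ![1, 0]) 1 *
          ∑ c : Fin 4 → Fin q, cycleWeight c * oppositeCount c := by
    rw [Finset.mul_sum, Finset.mul_sum, ← Finset.sum_add_distrib]
    refine Finset.sum_congr rfl fun c _ => ?_
    rw [chainWeight_layer, Fintype.card_fin]
    ring
  rw [card_strip_colorings, h, sum_cycleWeight, sum_cycleWeight_mul_oppositeCount,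
    Nat.add_sub_cancel, ← stripTransfer, Fintype.card_fin]
  simp only [dotProduct, Fin.sum_univ_two, Matrix.cons_val_zero, Matrix.cons_val_one]
  ring
end

section
/- Let q and n be natural numbers with n ≥ 1, and let G be the 4×n square-lattice strip with free boundary conditions, i.e. the box product of the path graph on 4 vertices with the path graph on n vertices. Let T be the 3×3 integer matrix (with q cast to ℤ) T = [[q⁴−7q³+21q²−32q+21, 2q³−12q²+28q−24, q³−7q²+19q−20],[q−2, q²−4q+5, 3−q],[−1, −2q+4, q²−5q+7]]. Then the number of proper q-colorings of G equals q·(q−1)·(uᵀ·T^{n−1}·v), where u is the column vector ((q−1)², 2(q−1), q−2) and v is the column vector (1, 0, 0). -/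
open Matrix

open Finset

/-- The Kronecker delta with integer values. -/
def kdelta {α : Type*} [DecidableEq α] (a b : α) : ℤ := if a = b then 1 else 0

section
variable {α : Type*} [DecidableEq α]

lemma kdelta_comm (a b : α) : kdelta a b = kdelta b a := by
  simp [kdelta, eq_comm]

lemma kdelta_self (a : α) : kdelta a a = 1 := by simp [kdelta]

variable [Fintype α]

lemma sum_kdelta_mul (a : α) (F : α → ℤ) : ∑ t, kdelta a t * F t = F a := by
  simp [kdelta]

lemma sum_avoid_two (a b : α) (F : α → ℤ) :
    ∑ t, (1 - kdelta a t) * (1 - kdelta b t) * F t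
      = ∑ t, F t - F a - F b + kdelta a b * F a := by
  have h : ∀ t, (1 - kdelta a t) * (1 - kdelta b t) * F t
      = F t - kdelta a t * F t - kdelta b t * F t + kdelta a t * (kdelta b t * F t) := by
    intro t; ring
  simp only [h, sum_add_distrib, sum_sub_distrib, sum_kdelta_mul]
  rw [kdelta_comm b a]

/-- Summing an affine function of deltas over the colors avoiding `a` and `b`. -/
lemma sum_avoid_two_affine (a b c d : α) (x y z : ℤ) :
    ∑ t, (1 - kdelta a t) * (1 - kdelta b t) * (x + y * kdelta c t + z * kdelta d t)
      = (Fintype.card α - 2 + kdelta a b) * x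
        + y * (1 - kdelta c a - kdelta c b + kdelta a b * kdelta c a)
        + z * (1 - kdelta d a - kdelta d b + kdelta a b * kdelta d a) := by
  have h : ∀ c : α, ∑ t, kdelta c t = 1 := fun c => by simp [kdelta]
  rw [sum_avoid_two]
  simp only [sum_add_distrib, ← mul_sum, h, sum_const, card_univ, nsmul_eq_mul]
  ring

lemma sum_kdelta (a : α) : ∑ t, kdelta a t = 1 := by simp [kdelta]

lemma sum_outer_vertices (a d p r : α) (hpr : p ≠ r) (x y z : ℤ) :
    ∑ s, ∑ t, (1 - kdelta a s) * (1 - kdelta p s) * ((1 - kdelta d t) * (1 - kdelta r t) *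
        (x + y * (kdelta s r + kdelta p t) + z * kdelta s t))
      = (Fintype.card α - 2 + kdelta a p) *
          ((Fintype.card α - 2 + kdelta d r) * x + y * (1 - kdelta d p) + z)
        + ((Fintype.card α - 2 + kdelta d r) * y - z) * (1 - kdelta a r)
        + z * (kdelta d r - 1) *
          (1 - kdelta a d - kdelta d p + kdelta a p * kdelta a d) := by
  have h1 : ∀ s, ∑ t, (1 - kdelta a s) * (1 - kdelta p s) * ((1 - kdelta d t) * (1 - kdelta r t) *
        (x + y * (kdelta s r + kdelta p t) + z * kdelta s t))
      = (1 - kdelta a s) * (1 - kdelta p s) *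
        (((Fintype.card α - 2 + kdelta d r) * x + y * (1 - kdelta d p) + z)
          + ((Fintype.card α - 2 + kdelta d r) * y - z) * kdelta r s
          + z * (kdelta d r - 1) * kdelta d s) := by
    intro s
    rw [← mul_sum]
    congr 1
    have := sum_avoid_two_affine d r p s (x + y * kdelta s r) y z
    simp only [mul_add, ← add_assoc] at this ⊢
    rw [this, kdelta_comm p d, kdelta_comm s r, kdelta_comm s d]
    have h0 : kdelta p r = 0 := by simp [kdelta, hpr]
    have h2 : kdelta d r * kdelta d p = 0 := by
      simp only [kdelta]; split_ifs <;> simp_all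
    linear_combination (-y) * h0 + y * h2
  simp only [h1]
  rw [sum_avoid_two_affine, kdelta_comm r a, kdelta_comm r p, kdelta_comm d a]
  have h0 : kdelta p r = 0 := by simp [kdelta, hpr]
  have h2 : kdelta a p * kdelta a r = 0 := by
    simp only [kdelta]; split_ifs <;> simp_all
  linear_combination ((Fintype.card α - 2 + kdelta d r) * y - z) * (h2 - h0)

lemma sum_second_vertex (a b d r : α) (hab : a ≠ b) (x y z : ℤ) :
    ∑ p, (1 - kdelta b p) * (1 - kdelta r p) *
      ∑ s, ∑ t, (1 - kdelta a s) * (1 - kdelta p s) * ((1 - kdelta d t) * (1 - kdelta r t) *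
        (x + y * (kdelta s r + kdelta p t) + z * kdelta s t))
      = ((Fintype.card α - 2 + kdelta b r) *
          ((Fintype.card α - 2) * ((Fintype.card α - 2 + kdelta d r) * x + y + z)
            + ((Fintype.card α - 2 + kdelta d r) * y - z) * (1 - kdelta a r)
            + z * (kdelta d r - 1) * (1 - kdelta a d))
        + ((Fintype.card α - 2 + kdelta d r) * x + y + z - y * kdelta a d
            + z * (kdelta d r - 1) * kdelta a d) * (1 - kdelta a r)
        + (z - (Fintype.card α - 2) * y) *
            (1 - kdelta b d - kdelta d r + kdelta b r * kdelta b d)) := by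
  have h1 : ∀ p, (1 - kdelta b p) * (1 - kdelta r p) *
      ∑ s, ∑ t, (1 - kdelta a s) * (1 - kdelta p s) * ((1 - kdelta d t) * (1 - kdelta r t) *
        (x + y * (kdelta s r + kdelta p t) + z * kdelta s t))
      = (1 - kdelta b p) * (1 - kdelta r p) *
        (((Fintype.card α - 2) * ((Fintype.card α - 2 + kdelta d r) * x + y + z)
            + ((Fintype.card α - 2 + kdelta d r) * y - z) * (1 - kdelta a r)
            + z * (kdelta d r - 1) * (1 - kdelta a d))
          + ((Fintype.card α - 2 + kdelta d r) * x + y + z - y * kdelta a d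
            + z * (kdelta d r - 1) * kdelta a d) * kdelta a p
          + (z - (Fintype.card α - 2) * y) * kdelta d p) := by
    intro p
    by_cases hpr : p = r
    · simp [hpr, kdelta_self]
    · rw [sum_outer_vertices a d p r hpr]
      congr 1
      have h2 : kdelta a p * kdelta d p = kdelta a p * kdelta a d := by
        simp only [kdelta]; split_ifs <;> simp_all
      have h3 : kdelta d r * kdelta d p = 0 := by
        simp only [kdelta]; split_ifs <;> simp_all
      linear_combination (-y) * h2 - z * h3
  simp only [h1]
  rw [sum_avoid_two_affine]
  have h0 : kdelta a b = 0 := by simp [kdelta, hab]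
  rw [h0, kdelta_comm d b]
  ring

lemma sum_avoid_one_affine (c a b d : α) (w x y z : ℤ) :
    ∑ t, (1 - kdelta c t) * (w + x * kdelta a t + y * kdelta b t + z * kdelta d t)
      = (Fintype.card α - 1) * w + x * (1 - kdelta a c) + y * (1 - kdelta b c)
        + z * (1 - kdelta d c) := by
  simp only [sub_mul, one_mul, sum_sub_distrib, sum_kdelta_mul, sum_add_distrib, ← mul_sum,
    sum_kdelta, sum_const, card_univ, nsmul_eq_mul]
  ring

/-- One step of the transfer matrix: summing an affine function of deltas over all proper columns
`(s, p, r, t)` compatible with the proper column `(a, b, c, d)`. -/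
lemma sum_compatible_columns (a b c d : α) (hab : a ≠ b) (hbc : b ≠ c) (hcd : c ≠ d) (x y z : ℤ) :
    ∑ r, (1 - kdelta c r) * ∑ p, (1 - kdelta b p) * (1 - kdelta r p) *
      ∑ s, ∑ t, (1 - kdelta a s) * (1 - kdelta p s) * ((1 - kdelta d t) * (1 - kdelta r t) *
        (x + y * (kdelta s r + kdelta p t) + z * kdelta s t))
      = (((Fintype.card α : ℤ)^4 - 7*(Fintype.card α : ℤ)^3 + 21*(Fintype.card α : ℤ)^2
            - 32*(Fintype.card α : ℤ) + 21) * x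
          + (2*(Fintype.card α : ℤ)^3 - 12*(Fintype.card α : ℤ)^2 + 28*(Fintype.card α : ℤ) - 24) * y
          + ((Fintype.card α : ℤ)^3 - 7*(Fintype.card α : ℤ)^2 + 19*(Fintype.card α : ℤ) - 20) * z)
        + (((Fintype.card α : ℤ) - 2) * x
          + ((Fintype.card α : ℤ)^2 - 4*(Fintype.card α : ℤ) + 5) * y
          + (3 - (Fintype.card α : ℤ)) * z) * (kdelta a c + kdelta b d)
        + (-x + (-2*(Fintype.card α : ℤ) + 4) * y
          + ((Fintype.card α : ℤ)^2 - 5*(Fintype.card α : ℤ) + 7) * z) * kdelta a d := by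
  simp only [sum_second_vertex a b d _ hab]
  have hac : kdelta b c = 0 := by simp [kdelta, hbc]
  have hdc : kdelta d c = 0 := by simp [kdelta, hcd.symm]
  set q : ℤ := (Fintype.card α : ℤ) with hq
  set Q : ℤ := q - 2
  set u := kdelta a c with hu
  set v := kdelta b d with hv
  set w := kdelta a d with hw
  have hwu : w = 0 ∨ (w = 1 ∧ u = 0 ∧ v = 0) := by
    simp only [hu, hv, hw, kdelta]
    by_cases had : a = d
    · right; subst had; simp [hcd.symm, hab.symm]
    · left; simp [had]
  set A := Q ^ 2 * x + 2 * Q * y + Q * z - 2 * z + z * w with hA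
  set B := Q * x + (y + z) * (1 - w) with hB
  set K := z - Q * y with hK
  set L := Q * x + y + z - (y + z) * w with hL
  rw [sum_congr rfl (g := fun r => (1 - kdelta c r) * ((Q * A + L + K * (1 - v))
    + (Q * K - L) * kdelta a r + (A + v * B + K * v) * kdelta b r
    + (Q * B + (x + z * w) - K - w * (x + z * w)) * kdelta d r))]
  · rw [sum_avoid_one_affine, hac, hdc, ← hq, ← hu]
    have hv2 : v = 0 ∨ v = 1 := by simp only [hv, kdelta]; split_ifs <;> simp
    have hu2 : u = 0 ∨ u = 1 := by simp only [hu, kdelta]; split_ifs <;> simp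
    rcases hwu with h | ⟨h, h', h''⟩
    · rcases hv2 with h' | h' <;> rcases hu2 with h'' | h'' <;>
        simp only [hA, hB, hK, hL, Q, h, h', h''] <;> ring
    · simp only [hA, hB, hK, hL, Q, h, h', h'']
      ring
  · intro r _
    congr 1
    have h1 : kdelta b r * kdelta a r = 0 := by
      simp only [kdelta]; split_ifs <;> simp_all
    have h2 : kdelta b r * kdelta d r = v * kdelta b r := by
      simp only [hv, kdelta]; split_ifs <;> simp_all
    have h3 : kdelta d r * kdelta a r = w * kdelta d r := by
      simp only [hw, kdelta]; split_ifs <;> simp_all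
    have hvw : v * w = 0 := by rcases hwu with h | ⟨-, -, h⟩ <;> simp [h]
    simp only [hA, hB, hK, hL]
    linear_combination (z - (Q + kdelta d r) * y) * h1 + (Q * x + z * (1 - w) + y) * h2
      + (-Q * y - x - z * w) * h3 + y * kdelta b r * hvw
end

section
variable {C : Type*} [Fintype C]

/-- Transfer-matrix count of the sequences starting at `c` whose terms satisfy `P` and whose
consecutive terms are related by `R`. -/
lemma card_chains_eq (P : C → Prop) (R : C → C → Prop) (w : ℕ → C → ℤ)
    [DecidablePred P] [DecidableRel R]
    (h0 : ∀ c, P c → w 0 c = 1)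
    (hs : ∀ m c, P c → w (m + 1) c = ∑ c', if P c' ∧ R c c' then w m c' else 0) (m : ℕ) (c : C) :
    (Nat.card {h : Fin m → C // (∀ i, P ((Fin.cons c h : Fin (m + 1) → C) i)) ∧
      ∀ i : Fin m, R ((Fin.cons c h : Fin (m + 1) → C) i.castSucc)
        ((Fin.cons c h : Fin (m + 1) → C) i.succ)} : ℤ) = if P c then w m c else 0 := by
  classical
  induction m generalizing c with
  | zero =>
    by_cases h : P c <;> simp [h, h0]
  | succ m ih =>
    have key : ∀ (c : C) (g : C × (Fin m → C)),
      ((∀ i, P ((Fin.cons c (Fin.cons g.1 g.2 : Fin (m + 1) → C) : Fin (m + 2) → C) i)) ∧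
      ∀ i : Fin (m + 1), R ((Fin.cons c (Fin.cons g.1 g.2 : Fin (m + 1) → C) : Fin (m + 2) → C) i.castSucc)
        ((Fin.cons c (Fin.cons g.1 g.2 : Fin (m + 1) → C) : Fin (m + 2) → C) i.succ)) ↔
      (P c ∧ R c g.1) ∧ ((∀ i, P ((Fin.cons g.1 g.2 : Fin (m + 1) → C) i)) ∧
      ∀ i : Fin m, R ((Fin.cons g.1 g.2 : Fin (m + 1) → C) i.castSucc)
        ((Fin.cons g.1 g.2 : Fin (m + 1) → C) i.succ)) := by
      intro c g
      rw [Fin.forall_fin_succ (n := m + 1), Fin.forall_fin_succ (n := m)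
        (P := fun i => R _ _)]
      simp only [Fin.cons_zero, Fin.cons_succ, Fin.castSucc_zero, ← Fin.succ_castSucc]
      tauto
    rw [← Nat.card_congr (((Fin.consEquiv (fun _ : Fin (m + 1) => C)).subtypeEquiv
      (fun g => (key c g).symm)))]
    simp only [Nat.card_eq_fintype_card, Fintype.card_subtype, card_filter, Fintype.sum_prod_type] at ih ⊢
    push_cast at ih ⊢
    by_cases hc : P c
    · rw [if_pos hc, hs m c hc]
      refine sum_congr rfl fun c' _ => ?_
      by_cases hr : R c c'
      · simp only [hc, hr, true_and, and_true]
        exact ih c'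
      · simp [hr]
    · simp [hc]

/-- A function on the `4 × n` grid, seen as the sequence of its columns. -/
def columnsEquiv (α : Type*) (n : ℕ) : (Fin 4 × Fin n → α) ≃ (Fin n → α × α × α × α) where
  toFun f j := (f (0, j), f (1, j), f (2, j), f (3, j))
  invFun h p := ![(h p.2).1, (h p.2).2.1, (h p.2).2.2.1, (h p.2).2.2.2] p.1
  left_inv f := by
    funext ⟨i, j⟩
    fin_cases i <;> rfl
  right_inv h := rfl

/-- The column is a proper coloring of the path on four vertices. -/
def IsProperColumn {α : Type*} (c : α × α × α × α) : Prop :=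
  c.1 ≠ c.2.1 ∧ c.2.1 ≠ c.2.2.1 ∧ c.2.2.1 ≠ c.2.2.2

/-- The two columns differ in every row. -/
def AreCompatible {α : Type*} (c c' : α × α × α × α) : Prop :=
  c.1 ≠ c'.1 ∧ c.2.1 ≠ c'.2.1 ∧ c.2.2.1 ≠ c'.2.2.1 ∧ c.2.2.2 ≠ c'.2.2.2

lemma proper_iff_columns {α : Type*} (m : ℕ) (f : Fin 4 × Fin (m + 1) → α) :
    (∀ a b, ((SimpleGraph.pathGraph 4).boxProd (SimpleGraph.pathGraph (m + 1))).Adj a b →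
      f a ≠ f b) ↔
    (∀ j, IsProperColumn (columnsEquiv α (m + 1) f j)) ∧
      ∀ j : Fin m, AreCompatible (columnsEquiv α (m + 1) f j.castSucc)
        (columnsEquiv α (m + 1) f j.succ) := by
  constructor
  · intro h
    refine ⟨fun j => ⟨?_, ?_, ?_⟩, fun j => ⟨?_, ?_, ?_, ?_⟩⟩ <;>
    · refine h _ _ ?_
      simp [SimpleGraph.boxProd_adj, SimpleGraph.pathGraph_adj]
  · rintro ⟨h1, h2⟩ ⟨i, j⟩ ⟨i', j'⟩ hadj
    have hsucc : ∀ (i : Fin 4) (j j' : Fin (m + 1)), j.val + 1 = j'.val → f (i, j) ≠ f (i, j') := by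
      intro i j j' hj
      obtain ⟨k, rfl, rfl⟩ : ∃ k : Fin m, j = k.castSucc ∧ j' = k.succ :=
        ⟨⟨j, by omega⟩, rfl, Fin.ext (by simp [hj])⟩
      obtain ⟨ha, hb, hc, hd⟩ := h2 k
      fin_cases i <;> assumption
    have hcol : ∀ (i i' : Fin 4) (j : Fin (m + 1)), i.val + 1 = i'.val → f (i, j) ≠ f (i', j) := by
      intro i i' j hi
      obtain ⟨ha, hb, hc⟩ := h1 j
      fin_cases i <;> fin_cases i' <;> simp at hi <;> assumption
    simp only [SimpleGraph.boxProd_adj, SimpleGraph.pathGraph_adj] at hadj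
    rcases hadj with ⟨h | h, rfl⟩ | ⟨h | h, rfl⟩
    · exact hcol _ _ _ h
    · exact (hcol _ _ _ h).symm
    · exact hsucc _ _ _ h
    · exact (hsucc _ _ _ h).symm

end

section
variable {α : Type*} [DecidableEq α]

/-- The function of a column spanned by `1`, `δ₁₃ + δ₂₄` and `δ₁₄` with coefficients `w`. -/
def columnFun (w : Fin 3 → ℤ) (c : α × α × α × α) : ℤ :=
  w 0 + w 1 * (kdelta c.1 c.2.2.1 + kdelta c.2.1 c.2.2.2) + w 2 * kdelta c.1 c.2.2.2

variable [Fintype α]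

open Classical in
lemma sum_columnFun (w : Fin 3 → ℤ) :
    ∑ c : α × α × α × α, (if IsProperColumn c then columnFun w c else 0)
      = (Fintype.card α : ℤ) * ((Fintype.card α : ℤ) - 1) *
        (![((Fintype.card α : ℤ) - 1)^2, 2*((Fintype.card α : ℤ) - 1), (Fintype.card α : ℤ) - 2]
          ⬝ᵥ w) := by
  have h1 : ∀ a b c d : α,
      (if IsProperColumn (a, b, c, d) then columnFun w (a, b, c, d) else 0)
      = (1 - kdelta a b) * ((1 - kdelta b c) * ((1 - kdelta c d) *
        ((w 0 + w 1 * kdelta a c) + w 1 * kdelta b d + w 2 * kdelta a d + 0 * kdelta a d))) := by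
    intro a b c d
    by_cases hab : a = b
    · simp [IsProperColumn, hab, kdelta_self]
    by_cases hbc : b = c
    · simp [IsProperColumn, hbc, kdelta_self]
    by_cases hcd : c = d
    · simp [IsProperColumn, hcd, kdelta_self]
    rw [if_pos (show IsProperColumn (a, b, c, d) from ⟨hab, hbc, hcd⟩)]
    simp only [columnFun]
    have h1 : kdelta a b = 0 := by simp [kdelta, hab]
    have h2 : kdelta b c = 0 := by simp [kdelta, hbc]
    have h3 : kdelta c d = 0 := by simp [kdelta, hcd]
    rw [h1, h2, h3]
    ring
  simp only [Fintype.sum_prod_type, h1, ← mul_sum, sum_avoid_one_affine]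
  generalize hq : (Fintype.card α : ℤ) = q
  have h2 : ∀ a b c : α, (q - 1) * (w 0 + w 1 * kdelta a c) + w 1 * (1 - kdelta b c)
      + w 2 * (1 - kdelta a c) + 0 * (1 - kdelta a c)
      = ((q - 1) * w 0 + w 1 + w 2) + ((q - 1) * w 1 - w 2) * kdelta a c
        + (-w 1) * kdelta b c + 0 * kdelta b c := by
    intro a b c; ring
  simp only [h2, sum_avoid_one_affine, hq]
  have h3 : ∀ a b : α, (q - 1) * ((q - 1) * w 0 + w 1 + w 2)
      + ((q - 1) * w 1 - w 2) * (1 - kdelta a b) + (-w 1) * (1 - kdelta b b)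
      + 0 * (1 - kdelta b b)
      = ((q - 1) * ((q - 1) * w 0 + w 1 + w 2) + ((q - 1) * w 1 - w 2))
        + (-((q - 1) * w 1 - w 2)) * kdelta a b + 0 * kdelta a b + 0 * kdelta a b := by
    intro a b; rw [kdelta_self]; ring
  simp only [h3]
  simp only [sum_avoid_one_affine, hq, kdelta_self, sum_const, card_univ, nsmul_eq_mul]
  simp [dotProduct, Fin.sum_univ_three]
  ring

/-- The transfer matrix of the free strip of width four, in the basis of `columnFun`. -/
def transferMatrix (q : ℤ) : Matrix (Fin 3) (Fin 3) ℤ :=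
  !![q^4 - 7*q^3 + 21*q^2 - 32*q + 21, 2*q^3 - 12*q^2 + 28*q - 24, q^3 - 7*q^2 + 19*q - 20;
     q - 2, q^2 - 4*q + 5, 3 - q;
     -1, -2*q + 4, q^2 - 5*q + 7]

open Classical in
lemma columnFun_transferMatrix_mulVec (w : Fin 3 → ℤ) (c : α × α × α × α)
    (hc : IsProperColumn c) :
    columnFun (transferMatrix (Fintype.card α) *ᵥ w) c
      = ∑ c', if IsProperColumn c' ∧ AreCompatible c c' then columnFun w c' else 0 := by
  obtain ⟨a, b, c, d⟩ := c
  obtain ⟨hab, hbc, hcd⟩ := hc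
  have h1 : ∀ s p r t : α,
      (if IsProperColumn (s, p, r, t) ∧ AreCompatible (a, b, c, d) (s, p, r, t)
        then columnFun w (s, p, r, t) else 0)
      = (1 - kdelta c r) * ((1 - kdelta b p) * (1 - kdelta r p) *
        ((1 - kdelta a s) * (1 - kdelta p s) * ((1 - kdelta d t) * (1 - kdelta r t) *
        (w 0 + w 1 * (kdelta s r + kdelta p t) + w 2 * kdelta s t)))) := by
    intro s p r t
    have hk : ∀ x y : α, 1 - kdelta x y = if x ≠ y then 1 else 0 := by
      intro x y
      by_cases h : x = y <;> simp [kdelta, h]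
    simp only [hk, ite_mul, one_mul, zero_mul, ← ite_and]
    refine if_congr ?_ rfl rfl
    simp only [IsProperColumn, AreCompatible, ne_comm (a := r) (b := p), ne_comm (a := p) (b := s)]
    tauto
  have h2 := sum_compatible_columns a b c d hab hbc hcd (w 0) (w 1) (w 2)
  simp only [Fintype.sum_prod_type, h1]
  rw [sum_comm, sum_congr rfl fun p _ => sum_comm, sum_comm]
  simp only [← mul_sum] at h2 ⊢
  rw [h2]
  simp [columnFun, transferMatrix, mulVec, dotProduct, Fin.sum_univ_three]
end

/-- Transfer-matrix formula for the chromatic polynomial of the `4 × n` square-lattice strip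
with free boundary conditions (`P₄ □ Pₙ`): the number of proper `q`-colorings equals
`q (q-1) · uᵀ T^{n-1} v` with the indicated `3 × 3` transfer matrix `T` and vectors
`u = ((q-1)², 2(q-1), q-2)`, `v = (1, 0, 0)`. -/
theorem chromatic_polynomial_square_strip_4F
    (q n : ℕ) (hn : 1 ≤ n) :
    (Nat.card {f : Fin 4 × Fin n → Fin q //
        ∀ a b, ((SimpleGraph.pathGraph 4).boxProd (SimpleGraph.pathGraph n)).Adj a b →
          f a ≠ f b} : ℤ) =
      (q : ℤ) * ((q : ℤ) - 1) *
        (![((q : ℤ) - 1)^2, 2*((q : ℤ) - 1), (q : ℤ) - 2] ⬝ᵥ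
          ((!![(q : ℤ)^4 - 7*(q : ℤ)^3 + 21*(q : ℤ)^2 - 32*(q : ℤ) + 21,
               2*(q : ℤ)^3 - 12*(q : ℤ)^2 + 28*(q : ℤ) - 24,
               (q : ℤ)^3 - 7*(q : ℤ)^2 + 19*(q : ℤ) - 20;
               (q : ℤ) - 2, (q : ℤ)^2 - 4*(q : ℤ) + 5, 3 - (q : ℤ);
               -1, -2*(q : ℤ) + 4, (q : ℤ)^2 - 5*(q : ℤ) + 7]) ^ (n - 1)).mulVec
            ![1, 0, 0]) := by
  change _ = (q : ℤ) * ((q : ℤ) - 1) * (_ ⬝ᵥ (transferMatrix q ^ (n - 1)) *ᵥ _)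
  classical
  obtain ⟨m, rfl⟩ := Nat.exists_eq_add_of_le' hn
  rw [Nat.add_sub_cancel]
  have hsum := sum_columnFun (α := Fin q) (transferMatrix q ^ m *ᵥ ![1, 0, 0])
  rw [Fintype.card_fin] at hsum
  rw [← hsum]
  have hchain := card_chains_eq (C := Fin q × Fin q × Fin q × Fin q) IsProperColumn AreCompatible
    (fun m => columnFun (transferMatrix q ^ m *ᵥ ![1, 0, 0]))
    (fun c _ => by simp [columnFun])
    (fun m c hc => by
      rw [← columnFun_transferMatrix_mulVec _ c hc, mulVec_mulVec, Fintype.card_fin, pow_succ'])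
    m
  simp only [← hchain]
  rw [Nat.card_congr ((columnsEquiv (Fin q) (m + 1)).subtypeEquiv
      (q := fun h => (∀ j, IsProperColumn (h j)) ∧
        ∀ j : Fin m, AreCompatible (h j.castSucc) (h j.succ)) (proper_iff_columns m)),
    ← Nat.card_congr ((Fin.consEquiv (fun _ : Fin (m + 1) => Fin q × Fin q × Fin q × Fin q)).subtypeEquiv
      (fun g => Iff.rfl))]
  simp only [Nat.card_eq_fintype_card, Fintype.card_subtype, card_filter, Fintype.sum_prod_type]
  push_cast
  rfl
end

section
/- For every natural number m ≥ 1, the number of non-crossing partitions of the set {0, 1, …, m−1} equals the m-th Catalan number C_m = (1/(m+1))·binom(2m, m). -/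
/-- A finite partition of `{0,…,m-1}` is non-crossing if whenever `a < b < c < d` with
`a, c` in one block and `b, d` in one block, all four lie in a common block. -/
def Finpartition.IsNoncrossing {m : ℕ}
    (P : Finpartition (Finset.univ : Finset (Fin m))) : Prop :=
  ∀ a b c d : Fin m, a < b → b < c → c < d →
    (∃ B ∈ P.parts, a ∈ B ∧ c ∈ B) → (∃ B ∈ P.parts, b ∈ B ∧ d ∈ B) →
    ∃ B ∈ P.parts, a ∈ B ∧ b ∈ B ∧ c ∈ B ∧ d ∈ B

/-- `r` is an equivalence relation on `ℕ` with non-crossing classes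
which is trivial outside `{0,…,n-1}`. -/
structure IsNoncrossingRel (n : ℕ) (r : ℕ → ℕ → Prop) : Prop where
  refl : ∀ x, r x x
  symm : ∀ x y, r x y → r y x
  trans : ∀ x y z, r x y → r y z → r x z
  lt : ∀ x y, r x y → x ≠ y → x < n
  noncrossing : ∀ a b c d, a < b → b < c → c < d → r a c → r b d → r a b

namespace IsNoncrossingRel

/-- Add `k` to the class of `0` in `s`, and place `t` to the right of `k`. -/
def glue (k : ℕ) (s t : ℕ → ℕ → Prop) (x y : ℕ) : Prop :=
  (x ≤ k ∧ y ≤ k ∧ s (if x = k then 0 else x) (if y = k then 0 else y)) ∨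
    (k < x ∧ k < y ∧ t (x - (k + 1)) (y - (k + 1)))

theorem glue_isNoncrossingRel {n k : ℕ} {s t : ℕ → ℕ → Prop} (hk : k ≤ n)
    (hs : IsNoncrossingRel k s) (ht : IsNoncrossingRel (n - k) t) :
    IsNoncrossingRel (n + 1) (glue k s t) := by
  obtain ⟨s1, s2, s3, s4, s5⟩ := hs
  obtain ⟨t1, t2, t3, t4, t5⟩ := ht
  refine ⟨fun x => ?_, fun x y h => ?_, fun x y z h h' => ?_, fun x y h hne => ?_,
    fun a b c d hab hbc hcd h h' => ?_⟩
  · rcases le_or_gt x k with hx | hx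
    · exact Or.inl ⟨hx, hx, s1 _⟩
    · exact Or.inr ⟨hx, hx, t1 _⟩
  · rcases h with ⟨hx, hy, h⟩ | ⟨hx, hy, h⟩
    · exact Or.inl ⟨hy, hx, s2 _ _ h⟩
    · exact Or.inr ⟨hy, hx, t2 _ _ h⟩
  · rcases h with ⟨hx, hy, h⟩ | ⟨hx, hy, h⟩ <;> rcases h' with ⟨hy', hz, h'⟩ | ⟨hy', hz, h'⟩
    · exact Or.inl ⟨hx, hz, s3 _ _ _ h h'⟩
    · omega
    · omega
    · exact Or.inr ⟨hx, hz, t3 _ _ _ h h'⟩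
  · rcases h with ⟨hx, hy, h⟩ | ⟨hx, hy, h⟩
    · omega
    · have := t4 _ _ h (by omega)
      omega
  · rcases h with ⟨ha, hc, h⟩ | ⟨ha, hc, h⟩ <;> rcases h' with ⟨hb, hd, h'⟩ | ⟨hb, hd, h'⟩
    · refine Or.inl ⟨ha, hb, ?_⟩
      rw [if_neg (by omega)] at h h' ⊢
      rw [if_neg (by omega)] at h ⊢
      split_ifs at h' with hdk
      · rcases Nat.eq_zero_or_pos a with rfl | h0
        · exact s2 _ _ h'
        · have h0b := s2 _ _ h'
          exact s3 _ _ _ (s2 _ _ (s5 0 a b c h0 hab hbc h0b h)) h0b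
      · exact s5 _ _ _ _ hab hbc hcd h h'
    · omega
    · omega
    · exact Or.inr ⟨ha, hb, t5 _ _ _ _ (by omega) (by omega) (by omega) h h'⟩

theorem glue_zero_self {n k : ℕ} {s t : ℕ → ℕ → Prop} (hs : IsNoncrossingRel n s) :
    glue k s t 0 k := by
  refine Or.inl ⟨by omega, le_rfl, ?_⟩
  simpa using hs.refl 0

theorem le_of_glue_zero {k x : ℕ} {s t : ℕ → ℕ → Prop} (h : glue k s t 0 x) : x ≤ k := by
  rcases h with ⟨_, h, _⟩ | ⟨h, _⟩ <;> omega

theorem left_iff_glue {k : ℕ} {s t : ℕ → ℕ → Prop} (hs : IsNoncrossingRel k s) (x y : ℕ) :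
    s x y ↔ x = y ∨ (x < k ∧ y < k ∧ glue k s t x y) := by
  constructor
  · intro h
    by_cases hxy : x = y
    · exact Or.inl hxy
    · have hx := hs.lt _ _ h hxy
      have hy := hs.lt _ _ (hs.symm _ _ h) (Ne.symm hxy)
      refine Or.inr ⟨hx, hy, Or.inl ⟨hx.le, hy.le, ?_⟩⟩
      rwa [if_neg hx.ne, if_neg hy.ne]
  · rintro (rfl | ⟨hx, hy, ⟨_, _, h⟩ | ⟨h, _⟩⟩)
    · exact hs.refl _
    · rwa [if_neg hx.ne, if_neg hy.ne] at h
    · omega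

theorem right_iff_glue {k : ℕ} {s t : ℕ → ℕ → Prop} (x y : ℕ) :
    t x y ↔ glue k s t (x + (k + 1)) (y + (k + 1)) := by
  constructor
  · intro h
    exact Or.inr ⟨by omega, by omega, by simpa using h⟩
  · rintro (⟨h, _⟩ | ⟨_, _, h⟩)
    · omega
    · simpa using h

theorem exists_eq_glue {n : ℕ} {r : ℕ → ℕ → Prop} (hr : IsNoncrossingRel (n + 1) r) :
    ∃ k ≤ n, ∃ s t, IsNoncrossingRel k s ∧ IsNoncrossingRel (n - k) t ∧ glue k s t = r := by
  classical
  obtain ⟨r1, r2, r3, r4, r5⟩ := hr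
  obtain ⟨k, hkn, hk, hmax⟩ : ∃ k ≤ n, r 0 k ∧ ∀ x, r 0 x → x ≤ k := by
    refine ⟨Nat.findGreatest (r 0) n, Nat.findGreatest_le n,
      Nat.findGreatest_spec (P := r 0) (Nat.zero_le n) (r1 0), fun x hx => ?_⟩
    refine Nat.le_findGreatest ?_ hx
    by_cases h : x = 0
    · omega
    · exact Nat.lt_succ_iff.1 (r4 _ _ (r2 _ _ hx) h)
  have hsep : ∀ x y, x ≤ k → k < y → ¬ r x y := by
    intro x y hx hy h
    have h0 : r 0 x := by
      rcases Nat.eq_zero_or_pos x with rfl | hx0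
      · exact r1 0
      rcases hx.eq_or_lt with rfl | hxk
      · exact hk
      · exact r5 0 x k y hx0 hxk hy hk h
    have := hmax y (r3 _ _ _ h0 h)
    omega
  have hp : ∀ x, r x (if x = k then 0 else x) := by
    intro x
    split_ifs with h
    · exact h ▸ r2 _ _ hk
    · exact r1 x
  refine ⟨k, hkn, fun x y => x = y ∨ (x < k ∧ y < k ∧ r x y),
    fun x y => r (x + (k + 1)) (y + (k + 1)), ⟨?_, ?_, ?_, ?_, ?_⟩,
    ⟨fun _ => r1 _, fun _ _ => r2 _ _, fun _ _ _ => r3 _ _ _, fun x y h hne => ?_,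
      fun a b c d hab hbc hcd => r5 _ _ _ _ (by omega) (by omega) (by omega)⟩, ?_⟩
  · grind
  · grind
  · grind
  · grind
  · grind
  · have := r4 _ _ h (by omega)
    omega
  · funext x y
    refine propext ⟨?_, fun h => ?_⟩
    · rintro (⟨_, _, h⟩ | ⟨hx, hy, h⟩)
      · refine r3 _ _ _ (hp x) (r3 _ _ _ ?_ (r2 _ _ (hp y)))
        rcases h with h | ⟨_, _, h⟩
        · exact h ▸ r1 _
        · exact h
      · rwa [Nat.sub_add_cancel hx, Nat.sub_add_cancel hy] at h
    · rcases le_or_gt x k with hx | hx <;> rcases le_or_gt y k with hy | hy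
      · refine Or.inl ⟨hx, hy, ?_⟩
        have h' := r3 _ _ _ (r2 _ _ (hp x)) (r3 _ _ _ h (hp y))
        by_cases hk0 : k = 0
        · left
          split_ifs <;> omega
        · right
          refine ⟨?_, ?_, h'⟩ <;> split_ifs <;> omega
      · exact absurd h (hsep x y hx hy)
      · exact absurd (r2 _ _ h) (hsep y x hy hx)
      · refine Or.inr ⟨hx, hy, ?_⟩
        beta_reduce
        rwa [Nat.sub_add_cancel hx, Nat.sub_add_cancel hy]

/-- `glue` as a map of subtypes. -/
def glueSigma (n : ℕ)
    (p : Σ k : Fin (n + 1), {s // IsNoncrossingRel k s} × {t // IsNoncrossingRel (n - k) t}) :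
    {r // IsNoncrossingRel (n + 1) r} :=
  ⟨glue p.1 p.2.1.1 p.2.2.1,
    glue_isNoncrossingRel (Nat.lt_succ_iff.1 p.1.2) p.2.1.2 p.2.2.2⟩

theorem glueSigma_bijective (n : ℕ) : Function.Bijective (glueSigma n) := by
  constructor
  · rintro ⟨k, ⟨s, hs⟩, ⟨t, ht⟩⟩ ⟨k', ⟨s', hs'⟩, ⟨t', ht'⟩⟩ h
    have h : glue k s t = glue k' s' t' := congrArg Subtype.val h
    obtain rfl : k = k' := by
      have h1 := le_of_glue_zero (h ▸ glue_zero_self hs)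
      have h2 := le_of_glue_zero (h.symm ▸ glue_zero_self hs')
      exact Fin.ext (le_antisymm h1 h2)
    obtain rfl : s = s' := by
      funext x y
      rw [left_iff_glue (t := t) hs, left_iff_glue (t := t') hs', h]
    obtain rfl : t = t' := by
      funext x y
      rw [right_iff_glue (k := k) (s := s) (t := t), right_iff_glue (k := k) (s := s) (t := t'), h]
    rfl
  · rintro ⟨r, hr⟩
    obtain ⟨k, hk, s, t, hs, ht, h⟩ := exists_eq_glue hr
    exact ⟨⟨⟨k, Nat.lt_succ_iff.2 hk⟩, ⟨s, hs⟩, ⟨t, ht⟩⟩, Subtype.ext h⟩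

instance : Unique {r // IsNoncrossingRel 0 r} where
  default := ⟨Eq, by constructor <;> grind⟩
  uniq := by
    rintro ⟨r, hr⟩
    refine Subtype.ext (funext fun x => funext fun y => propext ⟨fun h => ?_, fun h => ?_⟩)
    · by_contra hne
      exact absurd (hr.lt _ _ h hne) (Nat.not_lt_zero x)
    · exact h ▸ hr.refl x

theorem finite_and_card_eq_catalan (n : ℕ) :
    Finite {r // IsNoncrossingRel n r} ∧ Nat.card {r // IsNoncrossingRel n r} = catalan n := by
  induction n using Nat.strong_induction_on with
  | _ n ih =>
    cases n with
    | zero => exact ⟨inferInstance, by simp⟩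
    | succ n =>
      have hfin : ∀ k ≤ n, Finite {r // IsNoncrossingRel k r} := fun k hk => (ih k (by omega)).1
      have (k : Fin (n + 1)) : Finite {r // IsNoncrossingRel k r} := hfin k (by omega)
      have (k : Fin (n + 1)) : Finite {r // IsNoncrossingRel (n - k) r} := hfin _ (by omega)
      refine ⟨Finite.of_surjective _ (glueSigma_bijective n).2, ?_⟩
      rw [← Nat.card_congr (Equiv.ofBijective _ (glueSigma_bijective n)), Nat.card_sigma,
        catalan_succ]
      refine Finset.sum_congr rfl fun k _ => ?_
      rw [Nat.card_prod, (ih k (by omega)).2, (ih (n - k) (by omega)).2]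

end IsNoncrossingRel

namespace Finpartition

variable {m : ℕ}

/-- The equivalence relation on `ℕ` whose nontrivial classes are blocks of `P`. -/
def natRel (P : Finpartition (Finset.univ : Finset (Fin m))) (x y : ℕ) : Prop :=
  x = y ∨ ∃ (hx : x < m) (hy : y < m), P.part ⟨x, hx⟩ = P.part ⟨y, hy⟩

theorem exists_mem_mem_iff_part_eq (P : Finpartition (Finset.univ : Finset (Fin m)))
    (a b : Fin m) : (∃ B ∈ P.parts, a ∈ B ∧ b ∈ B) ↔ P.part a = P.part b := by
  rw [← mem_part_iff_exists, P.mem_part_iff_part_eq_part (Finset.mem_univ _) (Finset.mem_univ _)]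

theorem natRel_val_iff (P : Finpartition (Finset.univ : Finset (Fin m))) (a b : Fin m) :
    P.natRel a b ↔ P.part a = P.part b := by
  constructor
  · rintro (h | ⟨_, _, h⟩)
    · rw [Fin.ext h]
    · exact h
  · exact fun h => Or.inr ⟨a.2, b.2, h⟩

theorem IsNoncrossing.natRel {P : Finpartition (Finset.univ : Finset (Fin m))}
    (hP : P.IsNoncrossing) : IsNoncrossingRel m P.natRel := by
  refine ⟨fun x => Or.inl rfl, ?_, ?_, ?_, ?_⟩
  · rintro x y (h | ⟨hx, hy, h⟩)
    · exact Or.inl h.symm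
    · exact Or.inr ⟨hy, hx, h.symm⟩
  · rintro x y z (rfl | ⟨hx, hy, h⟩) (rfl | ⟨hy', hz, h'⟩)
    · exact Or.inl rfl
    · exact Or.inr ⟨hy', hz, h'⟩
    · exact Or.inr ⟨hx, hy, h⟩
    · exact Or.inr ⟨hx, hz, h.trans h'⟩
  · rintro x y (h | ⟨hx, -, -⟩) hne
    · exact absurd h hne
    · exact hx
  · rintro a b c d hab hbc hcd (h | ⟨ha, hc, h⟩) (h' | ⟨hb, hd, h'⟩)
    · omega
    · omega
    · omega
    · obtain ⟨B, hB, haB, hbB, -⟩ := hP ⟨a, ha⟩ ⟨b, hb⟩ ⟨c, hc⟩ ⟨d, hd⟩ hab hbc hcd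
        ((P.exists_mem_mem_iff_part_eq _ _).2 h) ((P.exists_mem_mem_iff_part_eq _ _).2 h')
      exact Or.inr ⟨ha, hb, (P.exists_mem_mem_iff_part_eq _ _).1 ⟨B, hB, haB, hbB⟩⟩

theorem eq_of_natRel_eq {P Q : Finpartition (Finset.univ : Finset (Fin m))}
    (h : P.natRel = Q.natRel) : P = Q := by
  have hpart : P.part = Q.part := by
    funext a
    ext b
    rw [P.mem_part_iff_part_eq_part (Finset.mem_univ _) (Finset.mem_univ _),
      Q.mem_part_iff_part_eq_part (Finset.mem_univ _) (Finset.mem_univ _),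
      ← natRel_val_iff, ← natRel_val_iff, h]
  have hparts (R : Finpartition (Finset.univ : Finset (Fin m))) (B : Finset (Fin m)) :
      B ∈ R.parts ↔ ∃ a, R.part a = B := by
    constructor
    · intro hB
      obtain ⟨a, -, ha⟩ := R.part_surjOn hB
      exact ⟨a, ha⟩
    · rintro ⟨a, rfl⟩
      exact R.part_mem.2 (Finset.mem_univ a)
  ext B
  rw [hparts, hparts, hpart]

theorem exists_natRel_eq {r : ℕ → ℕ → Prop} (hr : IsNoncrossingRel m r) :
    ∃ P : Finpartition (Finset.univ : Finset (Fin m)), P.IsNoncrossing ∧ P.natRel = r := by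
  classical
  let s : Setoid (Fin m) :=
    ⟨fun a b => r a b, fun a => hr.refl a, fun h => hr.symm _ _ h, fun h h' => hr.trans _ _ _ h h'⟩
  have key (a b : Fin m) : (ofSetoid s).part a = (ofSetoid s).part b ↔ r a b := by
    rw [← (ofSetoid s).mem_part_iff_part_eq_part (Finset.mem_univ _) (Finset.mem_univ _),
      mem_part_ofSetoid_iff_rel]
    exact ⟨hr.symm _ _, hr.symm _ _⟩
  refine ⟨ofSetoid s, ?_, ?_⟩
  · intro a b c d hab hbc hcd hac hbd
    rw [exists_mem_mem_iff_part_eq] at hac hbd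
    have h : (ofSetoid s).part a = (ofSetoid s).part b :=
      (key a b).2 (hr.noncrossing a b c d hab hbc hcd ((key a c).1 hac) ((key b d).1 hbd))
    have hmem (x : Fin m) : x ∈ (ofSetoid s).part x :=
      (ofSetoid s).mem_part (Finset.mem_univ x)
    exact ⟨_, (ofSetoid s).part_mem.2 (Finset.mem_univ a), hmem a, h ▸ hmem b, hac ▸ hmem c,
      (h.trans hbd) ▸ hmem d⟩
  · funext x y
    refine propext ⟨?_, fun h => ?_⟩
    · rintro (rfl | ⟨hx, hy, h⟩)
      · exact hr.refl x
      · exact (key ⟨x, hx⟩ ⟨y, hy⟩).1 h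
    · by_cases hxy : x = y
      · exact Or.inl hxy
      · exact Or.inr ⟨hr.lt _ _ h hxy, hr.lt _ _ (hr.symm _ _ h) (Ne.symm hxy), (key _ _).2 h⟩

end Finpartition

/-- The number of non-crossing partitions of `{0,…,m-1}` is the Catalan number `C_m`. -/
theorem card_noncrossing_partitions_eq_catalan (m : ℕ) (hm : 1 ≤ m) :
    Nat.card {P : Finpartition (Finset.univ : Finset (Fin m)) // P.IsNoncrossing} =
      catalan m := by
  rw [← (IsNoncrossingRel.finite_and_card_eq_catalan m).2]
  refine Nat.card_congr (Equiv.ofBijective (fun P => ⟨P.1.natRel, P.2.natRel⟩) ⟨?_, ?_⟩)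
  · intro P Q h
    exact Subtype.ext (Finpartition.eq_of_natRel_eq (congrArg Subtype.val h))
  · rintro ⟨r, hr⟩
    obtain ⟨P, hP, h⟩ := Finpartition.exists_natRel_eq hr
    exact ⟨⟨P, hP⟩, Subtype.ext h⟩
end
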